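/- arXiv:2203.16462 — 6 statements merged into one kernel-verified Lean document; each statement's English description precedes it below -/
import Mathlib

section
/- Let f : ℝ^p → [0,∞) be a nonnegative C² function, x₀ ∈ ℝ^p, r > 0, and α := α(x₀,r). Assume 4 f(x₀) < r² α. Then there is a unique solution φ : [0,∞) → ℝ^p of the gradient flow equation φ'(t) = −∇f(φ(t)) with φ(0) = x₀; this flow satisfies φ(t) ∈ B(x₀,r) for all t ≥ 0, and there exists x* ∈ B(x₀,r) with f(x*) = 0 such that for every t ≥ 0, |φ(t) − x*| ≤ r e^{−αt/2} and f(φ(t)) ≤ e^{−αt} f(x₀). -/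
open Set Filter Metric

section GlobalSolutions

variable {E : Type*} [NormedAddCommGroup E] [NormedSpace ℝ E]

/-- A bounded, globally Lipschitz vector field has a solution on all of `ℝ` through any point. -/
theorem LipschitzWith.exists_global_solution [CompleteSpace E] {v : E → E} {K L : NNReal}
    (hK : LipschitzWith K v) (hL : ∀ x, ‖v x‖ ≤ L) (x₀ : E) :
    ∃ φ : ℝ → E, φ 0 = x₀ ∧ ∀ t, HasDerivAt φ (v (φ t)) t := by
  have local_sol : ∀ a : ℝ, 0 < a → ∃ γ : ℝ → E, γ 0 = x₀ ∧
      ∀ t ∈ Ioo (-a) a, HasDerivAt γ (v (γ t)) t := by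
    intro a ha
    have hpl : IsPicardLindelof (fun _ => v) (tmin := -a) (tmax := a)
        ⟨0, by constructor <;> linarith⟩ x₀ (L * a.toNNReal) 0 L K :=
      { lipschitzOnWith := fun t _ => hK.lipschitzOnWith
        continuousOn := fun x _ => continuousOn_const
        norm_le := fun t _ x _ => hL x
        mul_max_le := by simp [ha.le] }
    obtain ⟨γ, h0, hγ⟩ := hpl.exists_eq_forall_mem_Icc_hasDerivWithinAt₀
    exact ⟨γ, h0, fun t ht => (hγ t (Ioo_subset_Icc_self ht)).hasDerivAt
      (Icc_mem_nhds ht.1 ht.2)⟩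
  choose! γ hγ0 hγ using local_sol
  have agree : ∀ a b, 0 < a → a ≤ b → EqOn (γ a) (γ b) (Ioo (-a) a) := by
    intro a b ha hab
    refine ODE_solution_unique_of_mem_Ioo (v := fun _ => v) (s := fun _ => univ) (K := K)
      (t₀ := 0) (fun _ _ => hK.lipschitzOnWith) ⟨by linarith, ha⟩
      (fun t ht => ⟨hγ a ha t ht, trivial⟩)
      (fun t ht => ⟨hγ b (ha.trans_le hab) t ⟨by linarith [ht.1], by linarith [ht.2]⟩, trivial⟩) ?_
    rw [hγ0 a ha, hγ0 b (ha.trans_le hab)]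
  have glue : ∀ a > 0, EqOn (fun t => γ (|t| + 1) t) (γ a) (Ioo (-a) a) := by
    intro a ha t ht
    have hpos : 0 < |t| + 1 := by positivity
    have hmem : t ∈ Ioo (-(|t| + 1)) (|t| + 1) := abs_lt.mp (lt_add_one _)
    rcases le_total (|t| + 1) a with h | h
    · exact agree _ _ hpos h hmem
    · exact (agree _ _ ha h ht).symm
  refine ⟨fun t => γ (|t| + 1) t, hγ0 _ (by positivity), fun t => ?_⟩
  have hpos : 0 < |t| + 1 := by positivity
  have hmem : t ∈ Ioo (-(|t| + 1)) (|t| + 1) := abs_lt.mp (lt_add_one _)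
  exact (hγ _ hpos t hmem).congr_of_eventuallyEq
    ((glue _ hpos).eventuallyEq_of_mem (Ioo_mem_nhds hmem.1 hmem.2))

/-- Forward uniqueness of solutions for a `C¹` vector field. -/
theorem ContDiff.eqOn_Ici_of_hasDerivWithinAt [ProperSpace E] {v : E → E} (hv : ContDiff ℝ 1 v)
    {φ ψ : ℝ → E} (h0 : φ 0 = ψ 0)
    (hφ : ∀ t ∈ Ici (0 : ℝ), HasDerivWithinAt φ (v (φ t)) (Ici 0) t)
    (hψ : ∀ t ∈ Ici (0 : ℝ), HasDerivWithinAt ψ (v (ψ t)) (Ici 0) t) :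
    EqOn φ ψ (Ici 0) := by
  intro T hT
  have hcφ : ContinuousOn φ (Icc 0 T) := fun t ht =>
    (hφ t ht.1).continuousWithinAt.mono Icc_subset_Ici_self
  have hcψ : ContinuousOn ψ (Icc 0 T) := fun t ht =>
    (hψ t ht.1).continuousWithinAt.mono Icc_subset_Ici_self
  obtain ⟨R, hR⟩ := (((isCompact_Icc.image_of_continuousOn hcφ).union
    (isCompact_Icc.image_of_continuousOn hcψ)).isBounded).subset_closedBall (0 : E)
  obtain ⟨K, hK⟩ := (hv.locallyLipschitz.locallyLipschitzOn
    (s := closedBall (0 : E) R)).exists_lipschitzOnWith_of_compact (isCompact_closedBall 0 R)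
  exact ODE_solution_unique_of_mem_Icc_right (v := fun _ => v) (s := fun _ => closedBall 0 R)
    (fun _ _ => hK) hcφ (fun t ht => (hφ t ht.1).mono (Ici_subset_Ici.2 ht.1))
    (fun t ht => hR (Or.inl (mem_image_of_mem _ (Ico_subset_Icc_self ht))))
    hcψ (fun t ht => (hψ t ht.1).mono (Ici_subset_Ici.2 ht.1))
    (fun t ht => hR (Or.inr (mem_image_of_mem _ (Ico_subset_Icc_self ht)))) h0 ⟨hT, le_rfl⟩

/-- A `C¹` vector field agrees on a closed ball with a bounded Lipschitz field which is a
multiple of it by a function with values in `[0, 1]`. -/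
theorem ContDiff.exists_cutoff {F : Type*} [NormedAddCommGroup F] [InnerProductSpace ℝ F]
    [FiniteDimensional ℝ F] {v : F → F} (hv : ContDiff ℝ 1 v) (x₀ : F)
    {r : ℝ} (hr : 0 < r) :
    ∃ (χ : F → ℝ) (K L : NNReal), LipschitzWith K (fun x => χ x • v x) ∧
      (∀ x, ‖χ x • v x‖ ≤ L) ∧ ∀ x ∈ closedBall x₀ r, χ x = 1 := by
  let χ : ContDiffBump x₀ := ⟨r, r + 1, hr, by linarith⟩
  have hsm : ContDiff ℝ 1 (fun x => χ x • v x) := χ.contDiff.smul hv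
  have hcs : HasCompactSupport (fun x => χ x • v x) := χ.hasCompactSupport.smul_right
  obtain ⟨K, hK⟩ := hsm.lipschitzWith_of_hasCompactSupport hcs one_ne_zero
  obtain ⟨C, hC⟩ := hcs.exists_bound_of_continuous hsm.continuous
  exact ⟨χ, K, C.toNNReal, hK, fun x => (hC x).trans (Real.le_coe_toNNReal C),
    fun x hx => χ.one_of_mem_closedBall hx⟩

end GlobalSolutions

section GradientFlow

variable {E : Type*} [NormedAddCommGroup E] [InnerProductSpace ℝ E]

theorem ContDiff.gradient [CompleteSpace E] {f : E → ℝ} (hf : ContDiff ℝ 2 f) :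
    ContDiff ℝ 1 (gradient f) :=
  (InnerProductSpace.toDual ℝ E).symm.contDiff.comp (hf.fderiv_right (m := 1) (by norm_num))

theorem gradient_eq_zero_of_nonneg [CompleteSpace E] {f : E → ℝ} (hf0 : ∀ x, 0 ≤ f x) {x : E}
    (hx : f x = 0) : gradient f x = 0 := by
  have hmin : IsLocalMin f x := Eventually.of_forall fun y => hx ▸ hf0 y
  simp [_root_.gradient, hmin.fderiv_eq_zero]

theorem hasDerivAt_comp_curve_gradient [CompleteSpace E] {f : E → ℝ} {φ : ℝ → E}
    {φ' : E} {t : ℝ} (hf : DifferentiableAt ℝ f (φ t)) (hφ : HasDerivAt φ φ' t) :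
    HasDerivAt (fun s => f (φ s)) (inner ℝ (gradient f (φ t)) φ') t := by
  have h := hf.hasFDerivAt.comp_hasDerivAt t hφ
  rwa [← inner_gradient_left] at h

/-- If `α * y ≤ n ^ 2`, then `n` is at most `2 / √α` times the speed `n ^ 2 / (2 * √y)` at which
the square root of `y` decreases under a decrease of `y` at speed `n ^ 2`. -/
theorem le_two_div_sqrt_mul_of_mul_le_sq {α y n : ℝ} (hα : 0 < α) (hy : 0 < y) (hn : 0 ≤ n)
    (h : α * y ≤ n ^ 2) : n ≤ 2 / √α * (n ^ 2 / (2 * √y)) := by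
  have hs : √α * √y ≤ n := by
    rw [← Real.sqrt_mul hα.le]
    exact Real.sqrt_le_iff.2 ⟨hn, h⟩
  have h1 : 0 < √α := Real.sqrt_pos.2 hα
  have h2 : 0 < √y := Real.sqrt_pos.2 hy
  have : 2 / √α * (n ^ 2 / (2 * √y)) = n ^ 2 / (√α * √y) := by field_simp
  rw [this, le_div_iff₀ (by positivity)]
  nlinarith

variable {f : E → ℝ} {x₀ : E} {r α : ℝ} {φ : ℝ → E}

/-- A curve starting at `x₀` which follows the negative gradient while it is in the ball
never leaves the ball. -/
theorem mem_closedBall_of_gradient_flow [CompleteSpace E] (hf : Differentiable ℝ f)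
    (hα0 : 0 < α) (hα : ∀ x ∈ closedBall x₀ r, α * f x ≤ ‖gradient f x‖ ^ 2)
    (hmain : 2 / √α * √(f x₀) < r) {φ' : ℝ → E} (h0 : φ 0 = x₀)
    (hφ : ∀ t, HasDerivAt φ (φ' t) t) (hpos : ∀ t, 0 < f (φ t))
    (hgrad : ∀ t, φ t ∈ closedBall x₀ r → φ' t = -gradient f (φ t)) :
    ∀ t, 0 ≤ t → φ t ∈ closedBall x₀ r := by
  intro T hT
  set β := 2 / √α
  set δ := r - β * √(f x₀) with hδ
  have hβ0 : 0 ≤ β := by positivity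
  have hδ0 : 0 < δ := by linarith
  let B : ℝ → ℝ := fun t => β * (√(f x₀) - √(f (φ t))) + δ * (1 - Real.exp (-t))
  have hB_le : ∀ t, B t ≤ r := by
    intro t
    have h1 : 0 ≤ β * √(f (φ t)) := by positivity
    have h2 : 0 ≤ δ * Real.exp (-t) := by positivity
    simp only [B]
    linarith
  have hB : ∀ t, HasDerivAt B (β * (-(inner ℝ (gradient f (φ t)) (φ' t) / (2 * √(f (φ t)))))
      + δ * Real.exp (-t)) t := by
    intro t
    have h1 := (hasDerivAt_comp_curve_gradient (hf (φ t)) (hφ t)).sqrt (hpos t).ne'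
    have h2 := ((hasDerivAt_id t).neg.exp.const_sub 1).const_mul δ
    exact (((h1.const_sub √(f x₀)).const_mul β).add h2).congr_deriv (by simp)
  have key := image_norm_le_of_norm_deriv_right_lt_deriv_boundary (f := fun t => φ t - x₀)
    (f' := φ') (a := 0) (b := T) (B := B)
    (fun t _ => ((hφ t).sub_const x₀).continuousAt.continuousWithinAt)
    (fun t _ => ((hφ t).sub_const x₀).hasDerivWithinAt) (by simp [B, h0]) hB ?_ ⟨hT, le_rfl⟩
  · rw [mem_closedBall, dist_eq_norm]
    exact key.trans (hB_le T)
  · intro t _ ht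
    have hmem : φ t ∈ closedBall x₀ r := by
      rw [mem_closedBall, dist_eq_norm, ht]
      exact hB_le t
    have h1 := le_two_div_sqrt_mul_of_mul_le_sq hα0 (hpos t) (norm_nonneg _) (hα _ hmem)
    have h2 : 0 < δ * Real.exp (-t) := by positivity
    rw [hgrad t hmem, norm_neg, inner_neg_right, real_inner_self_eq_norm_sq, neg_div, neg_neg]
    linarith

/-- Exponential decay of `f` along a gradient flow on which `α * f ≤ ‖∇f‖ ^ 2`. -/
theorem gradient_flow_exp_decay [CompleteSpace E] (hf : Differentiable ℝ f)
    (hα : ∀ t, 0 ≤ t → α * f (φ t) ≤ ‖gradient f (φ t)‖ ^ 2)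
    (hφ : ∀ t, 0 ≤ t → HasDerivAt φ (-gradient f (φ t)) t) {t : ℝ} (ht : 0 ≤ t) :
    f (φ t) ≤ Real.exp (-(α * t)) * f (φ 0) := by
  have hd : ∀ s, 0 ≤ s → HasDerivAt (fun s => Real.exp (α * s) * f (φ s))
      (Real.exp (α * s) * (α * f (φ s) - ‖gradient f (φ s)‖ ^ 2)) s := by
    intro s hs
    have h1 := hasDerivAt_comp_curve_gradient (hf (φ s)) (hφ s hs)
    have h2 := ((hasDerivAt_id s).const_mul α).exp
    refine (h2.mul h1).congr_deriv ?_
    simp only [inner_neg_right, real_inner_self_eq_norm_sq, id, mul_one]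
    ring
  have hanti : AntitoneOn (fun s => Real.exp (α * s) * f (φ s)) (Ici 0) := by
    refine antitoneOn_of_deriv_nonpos (convex_Ici 0)
      (fun s hs => (hd s hs).continuousAt.continuousWithinAt) ?_ ?_
    · intro s hs
      rw [interior_Ici] at hs
      exact (hd s (le_of_lt hs)).differentiableAt.differentiableWithinAt
    · intro s hs
      rw [interior_Ici] at hs
      rw [(hd s (le_of_lt hs)).deriv]
      exact mul_nonpos_of_nonneg_of_nonpos (Real.exp_pos _).le
        (by linarith [hα s (le_of_lt hs)])
  have h := hanti (mem_Ici.2 le_rfl) (mem_Ici.2 ht) ht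
  simp only [mul_zero, Real.exp_zero, one_mul] at h
  rw [Real.exp_neg, inv_mul_eq_div, le_div_iff₀ (Real.exp_pos _)]
  linarith

/-- The distance travelled by a gradient flow is controlled by the square root of `f`. -/
theorem gradient_flow_dist_le [CompleteSpace E] (hf : Differentiable ℝ f) (hα0 : 0 < α)
    (hα : ∀ t, 0 ≤ t → α * f (φ t) ≤ ‖gradient f (φ t)‖ ^ 2)
    (hφ : ∀ t, 0 ≤ t → HasDerivAt φ (-gradient f (φ t)) t) (hpos : ∀ t, 0 < f (φ t))
    {s t : ℝ} (hs : 0 ≤ s) (hst : s ≤ t) :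
    ‖φ t - φ s‖ ≤ 2 / √α * √(f (φ s)) := by
  have hB : ∀ u, 0 ≤ u → HasDerivAt (fun u => 2 / √α * (√(f (φ s)) - √(f (φ u))))
      (2 / √α * (‖gradient f (φ u)‖ ^ 2 / (2 * √(f (φ u))))) u := by
    intro u hu
    have h1 := (hasDerivAt_comp_curve_gradient (hf (φ u)) (hφ u hu)).sqrt (hpos u).ne'
    refine ((h1.const_sub √(f (φ s))).const_mul (2 / √α)).congr_deriv ?_
    rw [inner_neg_right, real_inner_self_eq_norm_sq]
    ring
  have key := image_norm_le_of_norm_deriv_right_le_deriv_boundary' (f := fun u => φ u - φ s)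
    (a := s) (b := t)
    (fun u hu => ((hφ u (hs.trans hu.1)).sub_const (φ s)).continuousAt.continuousWithinAt)
    (fun u hu => ((hφ u (hs.trans hu.1)).sub_const (φ s)).hasDerivWithinAt) (by simp)
    (fun u hu => (hB u (hs.trans hu.1)).continuousAt.continuousWithinAt)
    (fun u hu => (hB u (hs.trans hu.1)).hasDerivWithinAt)
    (fun u hu => by
      rw [norm_neg]
      exact le_two_div_sqrt_mul_of_mul_le_sq hα0 (hpos u) (norm_nonneg _)
        (hα u (hs.trans hu.1))) ⟨hst, le_rfl⟩
  have h1 : 0 ≤ 2 / √α * √(f (φ t)) := by positivity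
  linarith

/-- The gradient flow started at `x₀` exists for all times and stays in the ball, where `f`
does not vanish along it unless `f x₀ = 0`. -/
theorem exists_gradient_flow_mem_closedBall [FiniteDimensional ℝ E] [CompleteSpace E]
    (hf : ContDiff ℝ 2 f) (hf0 : ∀ x, 0 ≤ f x) (hx₀ : 0 < f x₀) (hr : 0 < r) (hα0 : 0 < α)
    (hα : ∀ x ∈ closedBall x₀ r, α * f x ≤ ‖gradient f x‖ ^ 2)
    (hmain : 2 / √α * √(f x₀) < r) :
    ∃ φ : ℝ → E, φ 0 = x₀ ∧ (∀ t, 0 ≤ t → HasDerivAt φ (-gradient f (φ t)) t) ∧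
      (∀ t, 0 ≤ t → φ t ∈ closedBall x₀ r) ∧ ∀ t, 0 < f (φ t) := by
  obtain ⟨χ, K, L, hK, hL, hχ⟩ := hf.gradient.neg.exists_cutoff x₀ hr
  obtain ⟨φ, h0, hφ⟩ := hK.exists_global_solution hL x₀
  have hpos : ∀ t, 0 < f (φ t) := by
    intro t
    refine (hf0 _).lt_of_ne' fun hzero => hx₀.ne' ?_
    have hconst : φ = fun _ => φ t :=
      ODE_solution_unique_univ (v := fun _ x => χ x • -gradient f x) (s := fun _ => univ)
        (t₀ := t) (fun _ => hK.lipschitzOnWith) (fun s => ⟨hφ s, trivial⟩)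
        (fun s => ⟨by simpa [gradient_eq_zero_of_nonneg hf0 hzero] using
          hasDerivAt_const s (φ t), trivial⟩) rfl
    rw [← h0, hconst]
    exact hzero
  have hgrad : ∀ t, φ t ∈ closedBall x₀ r →
      χ (φ t) • -gradient f (φ t) = -gradient f (φ t) := fun t ht => by rw [hχ _ ht, one_smul]
  have hmem := mem_closedBall_of_gradient_flow (hf.differentiable two_ne_zero) hα0 hα hmain h0 hφ
    hpos hgrad
  exact ⟨φ, h0, fun t ht => hgrad t (hmem t ht) ▸ hφ t, hmem, hpos⟩

end GradientFlow

/-- **Theorem 1.1 (gradient flow).** If `f : ℝ^p → [0,∞)` is a nonnegative `C²` function,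
`x₀ ∈ ℝ^p`, `r > 0`, and `α` is the quantity `α(x₀,r)` (formalized here as: `α` satisfies the
defining lower-bound property `α ≤ ‖∇f x‖²/f x` for every `x` in the closed ball `B(x₀,r)` with
`f x ≠ 0`), and if `4 f(x₀) < r² α`, then there is a unique solution `φ` of the gradient flow
equation `φ' = -∇f(φ)` on `[0,∞)` with `φ 0 = x₀`; it stays in `B(x₀,r)` forever and converges
to some `x⋆ ∈ B(x₀,r)` with `f x⋆ = 0`, with `‖φ t - x⋆‖ ≤ r e^{-αt/2}` and
`f (φ t) ≤ e^{-αt} f(x₀)` for all `t ≥ 0`. -/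
theorem gradient_flow_converges_to_global_min
    {p : ℕ} (hp : 0 < p)
    (f : EuclideanSpace ℝ (Fin p) → ℝ)
    (hf : ContDiff ℝ 2 f) (hf0 : ∀ x, 0 ≤ f x)
    (x₀ : EuclideanSpace ℝ (Fin p)) (r : ℝ) (hr : 0 < r)
    (α : ℝ)
    (hα : ∀ x ∈ Metric.closedBall x₀ r, f x ≠ 0 → α * f x ≤ ‖gradient f x‖ ^ 2)
    (hmain : 4 * f x₀ < r ^ 2 * α) :
    ∃ φ : ℝ → EuclideanSpace ℝ (Fin p),
      φ 0 = x₀ ∧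
      (∀ t ∈ Set.Ici (0:ℝ), HasDerivWithinAt φ (-(gradient f (φ t))) (Set.Ici 0) t) ∧
      (∀ ψ : ℝ → EuclideanSpace ℝ (Fin p), ψ 0 = x₀ →
        (∀ t ∈ Set.Ici (0:ℝ), HasDerivWithinAt ψ (-(gradient f (ψ t))) (Set.Ici 0) t) →
        Set.EqOn ψ φ (Set.Ici 0)) ∧
      (∀ t ∈ Set.Ici (0:ℝ), φ t ∈ Metric.closedBall x₀ r) ∧
      ∃ xstar ∈ Metric.closedBall x₀ r, f xstar = 0 ∧
        Filter.Tendsto φ Filter.atTop (nhds xstar) ∧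
        ∀ t ∈ Set.Ici (0:ℝ),
          ‖φ t - xstar‖ ≤ r * Real.exp (-(α * t) / 2) ∧
          f (φ t) ≤ Real.exp (-(α * t)) * f x₀ := by
  have hα' : ∀ x ∈ closedBall x₀ r, α * f x ≤ ‖gradient f x‖ ^ 2 := by
    intro x hx
    by_cases h : f x = 0
    · rw [h, mul_zero]
      positivity
    · exact hα x hx h
  have hα0 : 0 < α := by
    have : 0 < r ^ 2 * α := (mul_nonneg zero_le_four (hf0 x₀)).trans_lt hmain
    exact pos_of_mul_pos_right this (sq_nonneg r)
  have hdist : 2 / √α * √(f x₀) < r := by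
    have h1 : 0 < √α := Real.sqrt_pos.2 hα0
    rw [div_mul_eq_mul_div, div_lt_iff₀ h1]
    refine lt_of_pow_lt_pow_left₀ 2 (by positivity) ?_
    rw [mul_pow, mul_pow, Real.sq_sqrt (hf0 x₀), Real.sq_sqrt hα0.le]
    linarith
  have huniq : ∀ φ : ℝ → EuclideanSpace ℝ (Fin p), φ 0 = x₀ →
      (∀ t ∈ Ici (0:ℝ), HasDerivWithinAt φ (-(gradient f (φ t))) (Ici 0) t) →
      ∀ ψ : ℝ → EuclideanSpace ℝ (Fin p), ψ 0 = x₀ →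
      (∀ t ∈ Ici (0:ℝ), HasDerivWithinAt ψ (-(gradient f (ψ t))) (Ici 0) t) →
      EqOn ψ φ (Ici 0) := fun φ h0 hφ ψ h0' hψ =>
    hf.gradient.neg.eqOn_Ici_of_hasDerivWithinAt (h0'.trans h0.symm) hψ hφ
  rcases (hf0 x₀).eq_or_lt' with hzero | hpos₀
  · have hφ : ∀ t ∈ Ici (0:ℝ), HasDerivWithinAt (fun _ : ℝ => x₀) (-(gradient f x₀)) (Ici 0) t := by
      intro t _
      rw [gradient_eq_zero_of_nonneg hf0 hzero, neg_zero]
      exact hasDerivWithinAt_const ..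
    refine ⟨fun _ => x₀, rfl, hφ, huniq _ rfl hφ, fun _ _ => mem_closedBall_self hr.le,
      x₀, mem_closedBall_self hr.le, hzero, tendsto_const_nhds, fun t _ => ⟨?_, ?_⟩⟩
    · rw [sub_self, norm_zero]
      positivity
    · simp [hzero]
  obtain ⟨φ, h0, hφ, hmem, hpos⟩ :=
    exists_gradient_flow_mem_closedBall hf hf0 hpos₀ hr hα0 hα' hdist
  have hφ' : ∀ t ∈ Ici (0:ℝ), HasDerivWithinAt φ (-(gradient f (φ t))) (Ici 0) t :=
    fun t ht => (hφ t ht).hasDerivWithinAt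
  have hdiff : Differentiable ℝ f := hf.differentiable two_ne_zero
  have hPL : ∀ t, 0 ≤ t → α * f (φ t) ≤ ‖gradient f (φ t)‖ ^ 2 := fun t ht => hα' _ (hmem t ht)
  have hdecay : ∀ t, 0 ≤ t → f (φ t) ≤ Real.exp (-(α * t)) * f x₀ := fun t ht =>
    h0 ▸ gradient_flow_exp_decay hdiff hPL hφ ht
  have htail : ∀ s t, 0 ≤ s → s ≤ t → ‖φ t - φ s‖ ≤ r * Real.exp (-(α * s) / 2) := by
    intro s t hs hst
    calc ‖φ t - φ s‖ ≤ 2 / √α * √(f (φ s)) := gradient_flow_dist_le hdiff hα0 hPL hφ hpos hs hst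
      _ ≤ 2 / √α * √(Real.exp (-(α * s)) * f x₀) := by gcongr; exact hdecay s hs
      _ = 2 / √α * √(f x₀) * Real.exp (-(α * s) / 2) := by
        rw [Real.sqrt_mul (Real.exp_pos _).le, Real.exp_half]
        ring
      _ ≤ r * Real.exp (-(α * s) / 2) := by gcongr
  have hexp : ∀ c > 0, Tendsto (fun t : ℝ => Real.exp (-(α * t) / c)) atTop (nhds 0) := by
    intro c hc
    refine Real.tendsto_exp_atBot.comp ?_
    exact (tendsto_neg_atTop_atBot.comp (tendsto_id.const_mul_atTop hα0)).atBot_div_const hc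
  have hcauchy : Cauchy (map φ atTop) := by
    refine Metric.cauchySeq_iff'.2 fun ε hε => ?_
    have hlim := (hexp 2 two_pos).const_mul r
    rw [mul_zero] at hlim
    obtain ⟨N, hN0, hN⟩ := ((eventually_ge_atTop (0:ℝ)).and (hlim.eventually_lt_const hε)).exists
    exact ⟨N, fun t ht => by rw [dist_eq_norm]; exact (htail N t hN0 ht).trans_lt hN⟩
  obtain ⟨xstar, hlim⟩ := cauchy_map_iff_exists_tendsto.1 hcauchy
  have hev : ∀ᶠ t : ℝ in atTop, 0 ≤ t := eventually_ge_atTop 0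
  have hfzero : f xstar = 0 := by
    have h1 : Tendsto (fun t => f (φ t)) atTop (nhds (f xstar)) :=
      (hf.continuous.tendsto xstar).comp hlim
    have h2 := (hexp 1 one_pos).mul_const (f x₀)
    simp only [div_one, zero_mul] at h2
    exact le_antisymm (le_of_tendsto_of_tendsto h1 h2 (hev.mono hdecay)) (hf0 _)
  refine ⟨φ, h0, hφ', huniq φ h0 hφ', fun t ht => hmem t ht, xstar,
    isClosed_closedBall.mem_of_tendsto hlim (hev.mono hmem), hfzero, hlim,
    fun t ht => ⟨?_, hdecay t ht⟩⟩
  rw [norm_sub_rev]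
  exact le_of_tendsto (hlim.sub_const (φ t)).norm
    ((eventually_ge_atTop t).mono fun s hs => htail t s ht hs)
end

section
/- Let f : ℝ^p → [0,∞) be a nonnegative C² function, x₀ ∈ ℝ^p, r > 0, and α := α(x₀,r). Assume 4 f(x₀) < r² α, and choose ε ∈ (0,1) such that 4 f(x₀) < (1−ε)² r² α. Let L₁ be a uniform upper bound on the magnitudes of the first-order partial derivatives of f on B(x₀,r), and L₂ a uniform upper bound on the magnitudes of the second-order partial derivatives of f on B(x₀,2r). Choose η > 0 with η ≤ min{ r/(L₁√p), 2ε/(L₂ p) }, and define x_{k+1} := x_k − η ∇f(x_k) for k ≥ 0. Then x_k ∈ B(x₀,r) for all k, x_k converges to a point x* ∈ B(x₀,r) with f(x*) = 0, and with δ := min{1, (1−ε) α η}, for each k: |x_k − x*| ≤ (1−δ)^{k/2} r and f(x_k) ≤ (1−δ)^k f(x₀). -/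
open Set Filter Metric

/-- Second-order upper bound along `[0, 1]` from a bound on the second derivative. -/
theorem le_add_add_of_second_deriv_le {φ φ₁ φ₂ : ℝ → ℝ} {M : ℝ}
    (hφ : ∀ t, HasDerivAt φ (φ₁ t) t) (hφ₁ : ∀ t, HasDerivAt φ₁ (φ₂ t) t)
    (hM : ∀ t ∈ Icc (0 : ℝ) 1, φ₂ t ≤ M) : φ 1 ≤ φ 0 + φ₁ 0 + M / 2 := by
  have hderiv : ∀ t ∈ Icc (0 : ℝ) 1, φ₁ t - M * t ≤ φ₁ 0 := by
    have hd : ∀ t, HasDerivAt (fun t => φ₁ t - M * t) (φ₂ t - M) t := fun t => by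
      simpa using (hφ₁ t).fun_sub ((hasDerivAt_id t).const_mul M)
    have hanti : AntitoneOn (fun t => φ₁ t - M * t) (Icc 0 1) := by
      refine antitoneOn_of_deriv_nonpos (convex_Icc 0 1)
        (fun t _ => (hd t).continuousAt.continuousWithinAt)
        (fun t _ => (hd t).differentiableAt.differentiableWithinAt) fun t ht => ?_
      rw [interior_Icc] at ht
      rw [(hd t).deriv]
      linarith [hM t (Ioo_subset_Icc_self ht)]
    intro t ht
    simpa using hanti (left_mem_Icc.2 zero_le_one) ht ht.1
  have hd : ∀ t, HasDerivAt (fun t => φ t - φ₁ 0 * t - M / 2 * t ^ 2) (φ₁ t - φ₁ 0 - M * t) t := by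
    intro t
    refine (((hφ t).fun_sub ((hasDerivAt_id t).const_mul (φ₁ 0))).fun_sub
      ((hasDerivAt_pow 2 t).const_mul (M / 2))).congr_deriv ?_
    norm_num
    ring
  have hanti : AntitoneOn (fun t => φ t - φ₁ 0 * t - M / 2 * t ^ 2) (Icc 0 1) := by
    refine antitoneOn_of_deriv_nonpos (convex_Icc 0 1)
      (fun t _ => (hd t).continuousAt.continuousWithinAt)
      (fun t _ => (hd t).differentiableAt.differentiableWithinAt) fun t ht => ?_
    rw [interior_Icc] at ht
    rw [(hd t).deriv]
    linarith [hderiv t (Ioo_subset_Icc_self ht)]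
  have := hanti (left_mem_Icc.2 zero_le_one) (right_mem_Icc.2 zero_le_one) zero_le_one
  norm_num at this
  linarith

theorem EuclideanSpace.clm_apply_eq_sum {p : ℕ} (A : EuclideanSpace ℝ (Fin p) →L[ℝ] ℝ)
    (v : EuclideanSpace ℝ (Fin p)) : A v = ∑ i, v i * A (EuclideanSpace.single i 1) := by
  conv_lhs => rw [← (EuclideanSpace.basisFun (Fin p) ℝ).sum_repr v]
  simp [map_sum]

/-- A convenient form of the Cauchy–Schwarz inequality for the `ℓ¹` norm. -/
theorem EuclideanSpace.sq_sum_abs_le {p : ℕ} (v : EuclideanSpace ℝ (Fin p)) :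
    (∑ i, |v i|) ^ 2 ≤ p * ‖v‖ ^ 2 := by
  have := sq_sum_le_card_mul_sum_sq (s := Finset.univ) (f := fun i => |v i|)
  simpa [EuclideanSpace.norm_sq_eq] using this

/-- The descent lemma for a `C²` function with entrywise bounded Hessian on a convex set. -/
theorem ContDiff.le_add_fderiv_add_of_partial_le {p : ℕ} {f : EuclideanSpace ℝ (Fin p) → ℝ}
    (hf : ContDiff ℝ 2 f) {s : Set (EuclideanSpace ℝ (Fin p))} (hs : Convex ℝ s) {L : ℝ}
    (hL : ∀ z ∈ s, ∀ i j : Fin p,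
      |fderiv ℝ (fun v => fderiv ℝ f v (EuclideanSpace.single i 1)) z
        (EuclideanSpace.single j 1)| ≤ L)
    (hL0 : 0 ≤ L) {y v : EuclideanSpace ℝ (Fin p)} (hy : y ∈ s) (hyv : y + v ∈ s) :
    f (y + v) ≤ f y + fderiv ℝ f y v + L * p * ‖v‖ ^ 2 / 2 := by
  have hline : ∀ t : ℝ, HasDerivAt (fun t : ℝ => y + t • v) v t := fun t => by
    simpa using ((hasDerivAt_id t).smul_const v).const_add y
  have hpart : ∀ i : Fin p,
      Differentiable ℝ (fun z => fderiv ℝ f z (EuclideanSpace.single i 1)) := fun i =>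
    ((hf.fderiv_right (m := 1) (by norm_num)).clm_apply contDiff_const).differentiable one_ne_zero
  have h1 : ∀ t : ℝ, HasDerivAt (fun t : ℝ => f (y + t • v))
      (∑ i, v i * fderiv ℝ f (y + t • v) (EuclideanSpace.single i 1)) t := fun t => by
    rw [← EuclideanSpace.clm_apply_eq_sum]
    exact ((hf.differentiable two_ne_zero _).hasFDerivAt).comp_hasDerivAt t (hline t)
  have h2 : ∀ t : ℝ, HasDerivAt
      (fun t : ℝ => ∑ i, v i * fderiv ℝ f (y + t • v) (EuclideanSpace.single i 1))
      (∑ i, v i * ∑ j, v j * fderiv ℝ (fun z => fderiv ℝ f z (EuclideanSpace.single i 1))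
        (y + t • v) (EuclideanSpace.single j 1)) t := fun t => by
    refine HasDerivAt.fun_sum fun i _ => HasDerivAt.const_mul _ ?_
    rw [← EuclideanSpace.clm_apply_eq_sum]
    exact ((hpart i _).hasFDerivAt).comp_hasDerivAt (f := fun t : ℝ => y + t • v) t (hline t)
  have hM : ∀ t ∈ Icc (0 : ℝ) 1,
      ∑ i, v i * ∑ j, v j * fderiv ℝ (fun z => fderiv ℝ f z (EuclideanSpace.single i 1))
        (y + t • v) (EuclideanSpace.single j 1) ≤ L * p * ‖v‖ ^ 2 := fun t ht => by
    have hmem : y + t • v ∈ s := hs.add_smul_mem hy hyv ht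
    calc _ ≤ ∑ i, |v i| * ∑ j, |v j| * L := by
          refine Finset.sum_le_sum fun i _ => (le_abs_self _).trans ?_
          rw [abs_mul]
          gcongr
          refine (Finset.abs_sum_le_sum_abs _ _).trans (Finset.sum_le_sum fun j _ => ?_)
          rw [abs_mul]
          gcongr
          exact hL _ hmem i j
      _ = L * (∑ i, |v i|) ^ 2 := by
          rw [← Finset.sum_mul, ← Finset.sum_mul]
          ring
      _ ≤ L * (p * ‖v‖ ^ 2) := by
          gcongr
          exact EuclideanSpace.sq_sum_abs_le v
      _ = _ := by ring
  have := le_add_add_of_second_deriv_le h1 h2 hM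
  simpa [← EuclideanSpace.clm_apply_eq_sum] using this

theorem fderiv_apply_gradient {p : ℕ} (f : EuclideanSpace ℝ (Fin p) → ℝ)
    (y : EuclideanSpace ℝ (Fin p)) : fderiv ℝ f y (gradient f y) = ‖gradient f y‖ ^ 2 := by
  rw [← real_inner_self_eq_norm_sq, inner_gradient_left]

theorem norm_gradient_le_of_partial_le {p : ℕ} {f : EuclideanSpace ℝ (Fin p) → ℝ}
    {y : EuclideanSpace ℝ (Fin p)} {L : ℝ} (hL0 : 0 ≤ L)
    (hL : ∀ i : Fin p, |fderiv ℝ f y (EuclideanSpace.single i 1)| ≤ L) :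
    ‖gradient f y‖ ≤ L * √p := by
  have hcoord : ∀ i, gradient f y i = fderiv ℝ f y (EuclideanSpace.single i 1) := fun i => by
    rw [← inner_gradient_left, EuclideanSpace.inner_single_right]
    simp
  rw [EuclideanSpace.norm_eq]
  refine Real.sqrt_le_iff.2 ⟨by positivity, ?_⟩
  rw [mul_pow, Real.sq_sqrt (Nat.cast_nonneg p)]
  calc ∑ i, ‖gradient f y i‖ ^ 2 ≤ ∑ _i : Fin p, L ^ 2 := by
        gcongr with i
        rw [hcoord]
        exact hL i
    _ = L ^ 2 * p := by simp [mul_comm]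

/-- The length of a gradient step is controlled by the decrease of the square root of the
objective, under a Łojasiewicz-type lower bound on the gradient `g`. -/
theorem step_le_sqrt_sub_sqrt {a b g α c η : ℝ} (ha : 0 ≤ a) (hb : 0 ≤ b) (hα : 0 < α)
    (hc : 0 < c) (hη : 0 < η) (hg : 0 ≤ g) (hag : α * a ≤ g ^ 2)
    (hdec : b ≤ a - c * η * g ^ 2) :
    η * g ≤ 2 / (c * √α) * (√a - √b) := by
  have hba : √b ≤ √a := Real.sqrt_le_sqrt (hdec.trans (sub_le_self _ (by positivity)))
  rcases hg.eq_or_lt with rfl | hg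
  · rw [mul_zero]
    exact mul_nonneg (by positivity) (sub_nonneg.2 hba)
  have hroot : √α * √a ≤ g := by
    rw [← Real.sqrt_mul hα.le]
    exact Real.sqrt_le_iff.2 ⟨hg.le, hag⟩
  have hsα : 0 < √α := Real.sqrt_pos.2 hα
  have hdiff : c * η * g ^ 2 ≤ 2 * √a * (√a - √b) := by
    nlinarith [Real.sq_sqrt ha, Real.sq_sqrt hb, sq_nonneg (√a - √b)]
  have hmul : c * √α * (η * g) * g ≤ 2 * (√a - √b) * g :=
    calc _ = √α * (c * η * g ^ 2) := by ring
      _ ≤ √α * (2 * √a * (√a - √b)) := by gcongr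
      _ = 2 * (√a - √b) * (√α * √a) := by ring
      _ ≤ _ := by
        have := sub_nonneg.2 hba
        gcongr
  rw [div_mul_eq_mul_div, le_div_iff₀ (by positivity)]
  linarith [le_of_mul_le_mul_right hmul hg]

/-- One step of gradient descent: the sufficient decrease inequality. -/
theorem gradient_step_decrease {p : ℕ} (hp : 0 < p) {f : EuclideanSpace ℝ (Fin p) → ℝ}
    (hf : ContDiff ℝ 2 f) {x₀ : EuclideanSpace ℝ (Fin p)} {r ε L₁ L₂ η : ℝ}
    (hL₁ : ∀ z ∈ closedBall x₀ r, ∀ i : Fin p,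
      |fderiv ℝ f z (EuclideanSpace.single i 1)| ≤ L₁)
    (hL₂ : ∀ z ∈ closedBall x₀ (2 * r), ∀ i j : Fin p,
      |fderiv ℝ (fun v => fderiv ℝ f v (EuclideanSpace.single i 1)) z
        (EuclideanSpace.single j 1)| ≤ L₂)
    (hr : 0 < r) (hε : 0 < ε) (hη : 0 < η) (hη₁ : η ≤ r / (L₁ * √p)) (hη₂ : η ≤ 2 * ε / (L₂ * p))
    {y : EuclideanSpace ℝ (Fin p)} (hy : y ∈ closedBall x₀ r) :
    f (y - η • gradient f y) ≤ f y - (1 - ε) * η * ‖gradient f y‖ ^ 2 := by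
  have hp' : (0 : ℝ) < p := Nat.cast_pos.2 hp
  have hden₁ : 0 < L₁ * √p := (div_pos_iff_of_pos_left hr).1 (hη.trans_le hη₁)
  have hden₂ : 0 < L₂ * p := (div_pos_iff_of_pos_left (by positivity)).1 (hη.trans_le hη₂)
  have hL₁0 : 0 < L₁ := pos_of_mul_pos_left hden₁ (Real.sqrt_nonneg _)
  have hL₂0 : 0 < L₂ := pos_of_mul_pos_left hden₂ hp'.le
  have hstep : η * ‖gradient f y‖ ≤ r :=
    calc _ ≤ η * (L₁ * √p) := by
          gcongr
          exact norm_gradient_le_of_partial_le hL₁0.le (hL₁ y hy)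
      _ ≤ r := (le_div_iff₀ hden₁).1 hη₁
  have hy2 : y ∈ closedBall x₀ (2 * r) := closedBall_subset_closedBall (by linarith) hy
  have hv : y + -(η • gradient f y) ∈ closedBall x₀ (2 * r) := by
    rw [mem_closedBall, dist_eq_norm] at hy ⊢
    calc _ = ‖(y - x₀) - η • gradient f y‖ := by congr 1; abel
      _ ≤ ‖y - x₀‖ + η * ‖gradient f y‖ := by
          refine (norm_sub_le _ _).trans_eq ?_
          rw [norm_smul, Real.norm_of_nonneg hη.le]
      _ ≤ 2 * r := by linarith
  have hdesc := hf.le_add_fderiv_add_of_partial_le (convex_closedBall _ _) hL₂ hL₂0.le hy2 hv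
  rw [← sub_eq_add_neg, map_neg, map_smul, fderiv_apply_gradient, norm_neg, norm_smul,
    Real.norm_of_nonneg hη.le, smul_eq_mul] at hdesc
  have hsmall : L₂ * p * η ≤ 2 * ε := by
    rw [mul_comm]
    exact (le_div_iff₀ hden₂).1 hη₂
  have : L₂ * p * η * (η * ‖gradient f y‖ ^ 2) ≤ 2 * ε * (η * ‖gradient f y‖ ^ 2) := by
    gcongr
  linarith

/-- **Theorem 1.2 (gradient descent).** Under the condition `4 f(x₀) < r² α` (with `α = α(x₀,r)`,
formalized by the defining lower-bound property of the infimum), choosing `ε ∈ (0,1)` with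
`4 f(x₀) < (1-ε)² r² α`, with `L₁` a uniform bound on the first-order partial derivatives of `f`
on `B(x₀,r)`, `L₂` a uniform bound on the second-order partial derivatives of `f` on `B(x₀,2r)`,
and a step size `0 < η ≤ min (r/(L₁√p)) (2ε/(L₂ p))`, the gradient descent iterates
`x_{k+1} = x_k − η ∇f(x_k)` stay in `B(x₀,r)` and converge to a point `x⋆ ∈ B(x₀,r)` where
`f x⋆ = 0`; moreover with `δ = min 1 ((1-ε)αη)` we have `‖x_k − x⋆‖ ≤ (1-δ)^{k/2} r` and
`f(x_k) ≤ (1-δ)^k f(x₀)` for every `k`. -/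
theorem gradient_descent_converges_to_global_min
    {p : ℕ} (hp : 0 < p)
    (f : EuclideanSpace ℝ (Fin p) → ℝ)
    (hf : ContDiff ℝ 2 f) (hf0 : ∀ x, 0 ≤ f x)
    (x₀ : EuclideanSpace ℝ (Fin p)) (r : ℝ) (hr : 0 < r)
    (α : ℝ)
    (hα : ∀ x ∈ Metric.closedBall x₀ r, f x ≠ 0 → α * f x ≤ ‖gradient f x‖ ^ 2)
    (hmain : 4 * f x₀ < r ^ 2 * α)
    (ε : ℝ) (hε : ε ∈ Set.Ioo (0:ℝ) 1)
    (hmainε : 4 * f x₀ < (1 - ε) ^ 2 * r ^ 2 * α)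
    (L₁ L₂ : ℝ)
    (hL₁ : ∀ z ∈ Metric.closedBall x₀ r, ∀ i : Fin p,
      |fderiv ℝ f z (EuclideanSpace.single i 1)| ≤ L₁)
    (hL₂ : ∀ z ∈ Metric.closedBall x₀ (2 * r), ∀ i j : Fin p,
      |fderiv ℝ (fun v => fderiv ℝ f v (EuclideanSpace.single i 1)) z
        (EuclideanSpace.single j 1)| ≤ L₂)
    (η : ℝ) (hη : 0 < η)
    (hηle : η ≤ min (r / (L₁ * Real.sqrt p)) (2 * ε / (L₂ * p)))
    (x : ℕ → EuclideanSpace ℝ (Fin p)) (hx0 : x 0 = x₀)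
    (hxrec : ∀ k : ℕ, x (k + 1) = x k - η • gradient f (x k))
    (δ : ℝ) (hδ : δ = min 1 ((1 - ε) * α * η)) :
    (∀ k : ℕ, x k ∈ Metric.closedBall x₀ r) ∧
    ∃ xstar ∈ Metric.closedBall x₀ r, f xstar = 0 ∧
      Filter.Tendsto x Filter.atTop (nhds xstar) ∧
      ∀ k : ℕ,
        ‖x k - xstar‖ ≤ Real.sqrt ((1 - δ) ^ k) * r ∧
        f (x k) ≤ (1 - δ) ^ k * f x₀ := by
  obtain ⟨hε0, hε1⟩ := hε
  have hc : 0 < 1 - ε := sub_pos.2 hε1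
  have hα0 : 0 < α := by
    have h4 : 0 < r ^ 2 * α := lt_of_le_of_lt (by linarith [hf0 x₀]) hmain
    exact pos_of_mul_pos_right h4 (sq_nonneg r)
  obtain ⟨hη₁, hη₂⟩ := le_min_iff.1 hηle
  set C := 2 / ((1 - ε) * √α) with hC
  have hC0 : 0 < C := by positivity
  have hCr : C * √(f x₀) ≤ r := by
    have hsq : √(f x₀) * 2 ≤ r * ((1 - ε) * √α) := by
      refine le_of_sq_le_sq ?_ (by positivity)
      rw [mul_pow, mul_pow, mul_pow, Real.sq_sqrt (hf0 x₀), Real.sq_sqrt hα0.le]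
      linarith
    rw [hC, div_mul_eq_mul_div, div_le_iff₀ (by positivity)]
    linarith
  have hlower : ∀ y ∈ closedBall x₀ r, α * f y ≤ ‖gradient f y‖ ^ 2 := fun y hy => by
    by_cases h : f y = 0
    · simp [h]
    · exact hα y hy h
  have hdec : ∀ k, x k ∈ closedBall x₀ r →
      f (x (k + 1)) ≤ f (x k) - (1 - ε) * η * ‖gradient f (x k)‖ ^ 2 := fun k hk => by
    rw [hxrec]
    exact gradient_step_decrease hp hf hL₁ hL₂ hr hε0 hη hη₁ hη₂ hk
  have hdist : ∀ k, x k ∈ closedBall x₀ r →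
      dist (x k) (x (k + 1)) ≤ C * (√(f (x k)) - √(f (x (k + 1)))) := fun k hk => by
    have hnorm : dist (x k) (x (k + 1)) = η * ‖gradient f (x k)‖ := by
      rw [hxrec, dist_eq_norm, sub_sub_cancel, norm_smul, Real.norm_of_nonneg hη.le]
    rw [hnorm]
    exact step_le_sqrt_sub_sqrt (hf0 _) (hf0 _) hα0 hc hη (norm_nonneg _) (hlower _ hk)
      (hdec k hk)
  have hball : ∀ k, dist x₀ (x k) ≤ C * (√(f x₀) - √(f (x k))) → x k ∈ closedBall x₀ r := by
    intro k hk
    rw [mem_closedBall']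
    nlinarith [Real.sqrt_nonneg (f (x k))]
  have hmem : ∀ k, x k ∈ closedBall x₀ r := fun k => by
    refine hball k ?_
    induction k with
    | zero => simp [hx0]
    | succ k ih =>
      linarith [dist_triangle x₀ (x k) (x (k + 1)), hdist k (hball k ih)]
  have hδ0 : 0 < δ := by
    rw [hδ]
    exact lt_min one_pos (by positivity)
  have hδ1 : 0 ≤ 1 - δ := sub_nonneg.2 (hδ ▸ min_le_left _ _)
  have hrate : ∀ k, f (x k) ≤ (1 - δ) ^ k * f x₀ := fun k => by
    induction k with
    | zero => simp [hx0]
    | succ k ih =>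
      have hδle : δ ≤ (1 - ε) * α * η := hδ ▸ min_le_right _ _
      calc f (x (k + 1)) ≤ f (x k) - (1 - ε) * η * ‖gradient f (x k)‖ ^ 2 := hdec k (hmem k)
        _ ≤ f (x k) - (1 - ε) * η * (α * f (x k)) := by
          gcongr
          exact hlower _ (hmem k)
        _ = f (x k) - (1 - ε) * α * η * f (x k) := by ring
        _ ≤ f (x k) - δ * f (x k) := by
          gcongr
          exact hf0 _
        _ = (1 - δ) * f (x k) := by ring
        _ ≤ (1 - δ) * ((1 - δ) ^ k * f x₀) := by gcongr
        _ = _ := by ring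
  have hpair : ∀ k m, k ≤ m → dist (x k) (x m) ≤ C * (√(f (x k)) - √(f (x m))) := by
    intro k m hkm
    induction m, hkm using Nat.le_induction with
    | base => simp
    | succ m _ ih => linarith [dist_triangle (x k) (x m) (x (m + 1)), hdist m (hmem m)]
  have hpair' : ∀ k m, k ≤ m → dist (x k) (x m) ≤ √((1 - δ) ^ k) * r := fun k m hkm =>
    calc dist (x k) (x m) ≤ C * (√(f (x k)) - √(f (x m))) := hpair k m hkm
      _ ≤ C * √(f (x k)) := by
        gcongr
        exact sub_le_self _ (Real.sqrt_nonneg _)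
      _ ≤ C * √((1 - δ) ^ k * f x₀) := by
        gcongr
        exact hrate k
      _ = √((1 - δ) ^ k) * (C * √(f x₀)) := by
        rw [Real.sqrt_mul (pow_nonneg hδ1 k)]
        ring
      _ ≤ _ := by gcongr
  have hpow : Tendsto (fun k : ℕ => (1 - δ) ^ k) atTop (nhds 0) :=
    tendsto_pow_atTop_nhds_zero_of_lt_one hδ1 (by linarith)
  have hbound : Tendsto (fun k : ℕ => √((1 - δ) ^ k) * r) atTop (nhds 0) := by
    simpa using (hpow.sqrt).mul_const r
  obtain ⟨xstar, hlim⟩ := cauchySeq_tendsto_of_complete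
    (cauchySeq_of_le_tendsto_0' _ hpair' hbound)
  refine ⟨hmem, xstar, isClosed_closedBall.mem_of_tendsto hlim (Eventually.of_forall hmem), ?_,
    hlim, fun k => ⟨?_, hrate k⟩⟩
  · refine le_antisymm ?_ (hf0 _)
    refine le_of_tendsto_of_tendsto' ((hf.continuous.tendsto xstar).comp hlim) ?_ hrate
    simpa using hpow.mul_const (f x₀)
  · rw [← dist_eq_norm]
    exact le_of_tendsto (tendsto_const_nhds.dist hlim)
      ((eventually_ge_atTop k).mono fun m hm => hpair' k m hm)
end

section
/- Let f : ℝ^p → [0,∞) be a nonnegative C² function, x₀ ∈ ℝ^p, r > 0, α := α(x₀,r), and let φ := φ_{x₀} be the gradient flow starting from x₀. If t ∈ [0, T_{x₀}) is such that φ(s) ∈ B(x₀,r) for all s ≤ t, then f(φ(s)) ≤ e^{−αs} f(x₀) for all s ≤ t. -/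
open Set Filter Metric ENNReal

noncomputable section

/-- `GradFlowOn f x S φ` says that the continuous function `φ` solves, on `[0,S]`, the integral
equation `φ t = x − ∫₀ᵗ ∇f(φ s) ds` of the gradient flow of `f` started at `x`. -/
def GradFlowOn {p : ℕ} (f : EuclideanSpace ℝ (Fin p) → ℝ) (x : EuclideanSpace ℝ (Fin p))
    (S : ℝ) (φ : ℝ → EuclideanSpace ℝ (Fin p)) : Prop :=
  ContinuousOn φ (Set.Icc 0 S) ∧
    ∀ t ∈ Set.Icc 0 S, φ t = x - ∫ s in (0:ℝ)..t, gradient f (φ s)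

/-- `GoodTime f x T` says that `T ≥ 0` and that for every `S ∈ [0,T]` there is a unique
continuous solution of the gradient flow integral equation on `[0,S]` started at `x`. -/
def GoodTime {p : ℕ} (f : EuclideanSpace ℝ (Fin p) → ℝ) (x : EuclideanSpace ℝ (Fin p))
    (T : ℝ) : Prop :=
  0 ≤ T ∧ ∀ S : ℝ, 0 ≤ S → S ≤ T →
    ∃ φ : ℝ → EuclideanSpace ℝ (Fin p), GradFlowOn f x S φ ∧
      ∀ ψ : ℝ → EuclideanSpace ℝ (Fin p), GradFlowOn f x S ψ → Set.EqOn ψ φ (Set.Icc 0 S)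

/-- `flowTime f x` is `T_x`: the supremum (in `ℝ≥0∞`) of all finite `T ≥ 0` such that for every
`S ≤ T` the gradient flow integral equation has a unique continuous solution on `[0,S]`. -/
def flowTime {p : ℕ} (f : EuclideanSpace ℝ (Fin p) → ℝ) (x : EuclideanSpace ℝ (Fin p)) : ℝ≥0∞ :=
  ⨆ (T : ℝ) (_ : GoodTime f x T), ENNReal.ofReal T

open Classical in
/-- `flow f x t` is `φ_x(t)`, the gradient flow of `f` started at `x`; for `t ∈ [0, T_x)` it is
the (unique) value at `t` of the solution of the gradient flow integral equation on `[0,t]`. -/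
def flow {p : ℕ} (f : EuclideanSpace ℝ (Fin p) → ℝ) (x : EuclideanSpace ℝ (Fin p)) (t : ℝ) :
    EuclideanSpace ℝ (Fin p) :=
  if h : ∃ φ : ℝ → EuclideanSpace ℝ (Fin p), GradFlowOn f x t φ ∧
      ∀ ψ : ℝ → EuclideanSpace ℝ (Fin p), GradFlowOn f x t ψ → Set.EqOn ψ φ (Set.Icc 0 t)
  then Classical.choose h t else x

/-- The gradient flow agrees, on `[0,T]` for any good time `T`, with a single solution of the
integral equation. -/
theorem GoodTime.exists_gradFlowOn_eqOn_flow {p : ℕ} {f : EuclideanSpace ℝ (Fin p) → ℝ}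
    {x : EuclideanSpace ℝ (Fin p)} {T : ℝ} (hT : GoodTime f x T) :
    ∃ φ : ℝ → EuclideanSpace ℝ (Fin p), GradFlowOn f x T φ ∧
      Set.EqOn (flow f x) φ (Set.Icc 0 T) := by
  obtain ⟨φ, hφ, -⟩ := hT.2 T hT.1 le_rfl
  refine ⟨φ, hφ, fun s hs => ?_⟩
  have h := hT.2 s hs.1 hs.2
  have hsub : Set.Icc 0 s ⊆ Set.Icc 0 T := Set.Icc_subset_Icc_right hs.2
  rw [flow, dif_pos h]
  exact ((Classical.choose_spec h).2 φ ⟨hφ.1.mono hsub, fun u hu => hφ.2 u (hsub hu)⟩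
    ⟨hs.1, le_rfl⟩).symm

/-- A time strictly below `flowTime` lies below some good time. -/
theorem exists_goodTime_of_ofReal_lt_flowTime {p : ℕ} {f : EuclideanSpace ℝ (Fin p) → ℝ}
    {x : EuclideanSpace ℝ (Fin p)} {t : ℝ} (h : ENNReal.ofReal t < flowTime f x) :
    ∃ T, GoodTime f x T ∧ t < T := by
  rw [flowTime] at h
  obtain ⟨T, h⟩ := lt_iSup_iff.1 h
  obtain ⟨hT, h⟩ := lt_iSup_iff.1 h
  exact ⟨T, hT, lt_of_not_ge fun hle => h.not_ge (ENNReal.ofReal_le_ofReal hle)⟩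

/-- A solution of the integral equation is differentiable in the interior of its interval. -/
theorem GradFlowOn.hasDerivAt {p : ℕ} {f : EuclideanSpace ℝ (Fin p) → ℝ}
    {x : EuclideanSpace ℝ (Fin p)} {S : ℝ} {φ : ℝ → EuclideanSpace ℝ (Fin p)}
    (hφ : GradFlowOn f x S φ) (hf : Continuous (gradient f)) {s : ℝ} (hs : s ∈ Set.Ioo 0 S) :
    HasDerivAt φ (-gradient f (φ s)) s := by
  have hc : ContinuousOn (fun u => gradient f (φ u)) (Set.Icc 0 S) := hf.comp_continuousOn hφ.1
  have hint : IntervalIntegrable (fun u => gradient f (φ u)) MeasureTheory.volume 0 s := by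
    apply ContinuousOn.intervalIntegrable
    rw [Set.uIcc_of_le hs.1.le]
    exact hc.mono (Set.Icc_subset_Icc_right hs.2.le)
  have hd := intervalIntegral.integral_hasDerivAt_right hint
    ((hc.mono Set.Ioo_subset_Icc_self).stronglyMeasurableAtFilter isOpen_Ioo s hs)
    (hc.continuousAt (Icc_mem_nhds hs.1 hs.2))
  refine (hd.const_sub x).congr_of_eventuallyEq ?_
  filter_upwards [Icc_mem_nhds hs.1 hs.2] with u hu using hφ.2 u hu

/-- Along a solution of the gradient flow on which `α * f ≤ ‖∇f‖²`, the function decays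
exponentially with rate `α`. -/
theorem GradFlowOn.le_exp_mul {p : ℕ} {f : EuclideanSpace ℝ (Fin p) → ℝ}
    {x : EuclideanSpace ℝ (Fin p)} {S α : ℝ} {φ : ℝ → EuclideanSpace ℝ (Fin p)}
    (hφ : GradFlowOn f x S φ) (hf : ContDiff ℝ 1 f)
    (hα : ∀ s ∈ Set.Icc 0 S, α * f (φ s) ≤ ‖gradient f (φ s)‖ ^ 2)
    {s : ℝ} (hs : s ∈ Set.Icc 0 S) :
    f (φ s) ≤ Real.exp (-(α * s)) * f x := by
  have hgrad : Continuous (gradient f) :=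
    (InnerProductSpace.toDual ℝ _).symm.continuous.comp (hf.continuous_fderiv one_ne_zero)
  have hzero : (0 : ℝ) ∈ Set.Icc 0 S := ⟨le_rfl, hs.1.trans hs.2⟩
  have hφ0 : φ 0 = x := by simpa using hφ.2 0 hzero
  have hanti : AntitoneOn (fun u => Real.exp (α * u) * f (φ u)) (Set.Icc 0 S) := by
    refine antitoneOn_of_hasDerivWithinAt_nonpos (convex_Icc 0 S)
      (f' := fun u => Real.exp (α * u) * α * f (φ u) +
        Real.exp (α * u) * -‖gradient f (φ u)‖ ^ 2) ?_ ?_ ?_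
    · exact (by fun_prop : Continuous fun u : ℝ => Real.exp (α * u)).continuousOn.mul
        (hf.continuous.comp_continuousOn hφ.1)
    · intro u hu
      rw [interior_Icc] at hu
      have hfφ := ((hf.differentiable one_ne_zero (φ u)).hasGradientAt.hasFDerivAt).comp_hasDerivAt u
        (hφ.hasDerivAt hgrad hu)
      have hexp : HasDerivAt (fun u => Real.exp (α * u)) (Real.exp (α * u) * α) u := by
        simpa using ((hasDerivAt_id u).const_mul α).exp
      have hprod := hexp.mul hfφ
      simp only [InnerProductSpace.toDual_apply_apply, inner_neg_right,
        real_inner_self_eq_norm_sq] at hprod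
      exact hprod.hasDerivWithinAt
    · intro u hu
      nlinarith [hα u (interior_subset hu), Real.exp_pos (α * u)]
  have h := hanti hzero hs hs.1
  simp only [mul_zero, Real.exp_zero, one_mul, hφ0] at h
  calc f (φ s) = Real.exp (-(α * s)) * (Real.exp (α * s) * f (φ s)) := by
        rw [← mul_assoc, ← Real.exp_add, neg_add_cancel, Real.exp_zero, one_mul]
    _ ≤ Real.exp (-(α * s)) * f x := by gcongr

/-- **Lemma 3.7.** If `t ∈ [0, T_{x₀})` is such that `φ(s) ∈ B(x₀,r)` for all `s ≤ t`, then
`f(φ(s)) ≤ e^{−αs} f(x₀)` for all `s ≤ t`. Here `α = α(x₀,r)` is formalized via its defining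
lower-bound property on the closed ball `B(x₀,r)`. -/
theorem loss_along_flow_exp_decay
    {p : ℕ} (hp : 0 < p)
    (f : EuclideanSpace ℝ (Fin p) → ℝ)
    (hf : ContDiff ℝ 2 f) (hf0 : ∀ x, 0 ≤ f x)
    (x₀ : EuclideanSpace ℝ (Fin p)) (r : ℝ) (hr : 0 < r)
    (α : ℝ)
    (hα : ∀ x ∈ Metric.closedBall x₀ r, f x ≠ 0 → α * f x ≤ ‖gradient f x‖ ^ 2)
    (t : ℝ) (ht : 0 ≤ t) (htT : ENNReal.ofReal t < flowTime f x₀)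
    (hball : ∀ s ∈ Set.Icc 0 t, flow f x₀ s ∈ Metric.closedBall x₀ r) :
    ∀ s ∈ Set.Icc 0 t, f (flow f x₀ s) ≤ Real.exp (-(α * s)) * f x₀ := by
  obtain ⟨T, hT, htT⟩ := exists_goodTime_of_ofReal_lt_flowTime htT
  have hTt : GoodTime f x₀ t := ⟨ht, fun S hS hSt => hT.2 S hS (hSt.trans htT.le)⟩
  obtain ⟨φ, hφ, hflow⟩ := hTt.exists_gradFlowOn_eqOn_flow
  intro s hs
  rw [hflow hs]
  refine hφ.le_exp_mul (hf.of_le one_le_two) (fun u hu => ?_) hs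
  by_cases h : f (φ u) = 0
  · rw [h, mul_zero]
    positivity
  · exact hα _ (hflow hu ▸ hball u hu) h
end
end

section
/- Let f : ℝ^p → [0,∞) be a nonnegative C² function, x₀ ∈ ℝ^p, r > 0, and α := α(x₀,r). Assume 4 f(x₀) < r² α. Then the gradient flow φ := φ_{x₀} starting from x₀ cannot visit the boundary of B(x₀,r); that is, |φ(t) − x₀| < r for all t ∈ [0, T_{x₀}). -/
open Set Filter Metric ENNReal

noncomputable section

/-- A solution of the gradient flow integral equation agrees on `[0,S]` with a function on `ℝ`
solving the gradient flow differential equation there. -/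
theorem GradFlowOn.exists_hasDerivAt {p : ℕ} {f : EuclideanSpace ℝ (Fin p) → ℝ}
    {x : EuclideanSpace ℝ (Fin p)} {S : ℝ} {φ : ℝ → EuclideanSpace ℝ (Fin p)}
    (h : GradFlowOn f x S φ) (hS : 0 ≤ S) (hf : Continuous (gradient f)) :
    ∃ ψ : ℝ → EuclideanSpace ℝ (Fin p), ψ 0 = x ∧ Set.EqOn ψ φ (Set.Icc 0 S) ∧
      Continuous ψ ∧ ∀ s ∈ Set.Icc 0 S, HasDerivAt ψ (-gradient f (ψ s)) s := by
  have hcont : Continuous (Set.IccExtend hS ((Set.Icc 0 S).domRestrict φ)) :=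
    (continuousOn_iff_continuous_domRestrict.1 h.1).Icc_extend'
  have hext : ∀ s ∈ Set.Icc 0 S, Set.IccExtend hS ((Set.Icc 0 S).domRestrict φ) s = φ s := by
    intro s hs
    rw [Set.IccExtend_of_mem hS _ hs]
    rfl
  set w := Set.IccExtend hS ((Set.Icc 0 S).domRestrict φ)
  have hd : ∀ s, HasDerivAt (fun t => x - ∫ u in (0:ℝ)..t, gradient f (w u))
      (-gradient f (w s)) s := fun s =>
    ((hf.comp hcont).integral_hasStrictDerivAt 0 s).hasDerivAt.const_sub x
  have heq : Set.EqOn (fun t => x - ∫ u in (0:ℝ)..t, gradient f (w u)) φ (Set.Icc 0 S) := by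
    intro s hs
    rw [h.2 s hs]
    refine congrArg (x - ·) (intervalIntegral.integral_congr fun u hu => ?_)
    rw [Set.uIcc_of_le hs.1] at hu
    simp only [hext u ⟨hu.1, hu.2.trans hs.2⟩]
  refine ⟨_, by simp, heq, continuous_iff_continuousAt.2 fun s => (hd s).continuousAt,
    fun s hs => ?_⟩
  have := hd s
  rwa [hext s hs, ← heq hs] at this

theorem gradient_eq_zero_of_nonneg_of_eq_zero {E : Type*} [NormedAddCommGroup E]
    [InnerProductSpace ℝ E] [CompleteSpace E] {f : E → ℝ} (hf0 : ∀ x, 0 ≤ f x) {x : E}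
    (hx : f x = 0) : gradient f x = 0 := by
  have hmin : IsLocalMin f x := Filter.Eventually.of_forall fun y => hx ▸ hf0 y
  simp [gradient, hmin.fderiv_eq_zero]

theorem hasDerivAt_comp_gradientFlow {E : Type*} [NormedAddCommGroup E]
    [InnerProductSpace ℝ E] [CompleteSpace E] {f : E → ℝ} {ψ : ℝ → E} {s : ℝ}
    (hf : DifferentiableAt ℝ f (ψ s)) (hψ : HasDerivAt ψ (-gradient f (ψ s)) s) :
    HasDerivAt (fun t => f (ψ t)) (-‖gradient f (ψ s)‖ ^ 2) s := by
  have := hf.hasGradientAt.hasFDerivAt.comp_hasDerivAt s hψ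
  rwa [InnerProductSpace.toDual_apply_apply, inner_neg_right, real_inner_self_eq_norm_sq] at this

/-- If `‖∇f‖² ≥ α f > 0` along a gradient flow line on `[0,σ)`, then its displacement at time `σ`
is at most `(2 / √α) √(f (ψ 0))`. -/
theorem norm_sub_le_of_gradientFlow {E : Type*} [NormedAddCommGroup E]
    [InnerProductSpace ℝ E] [CompleteSpace E] {f : E → ℝ} (hf : Differentiable ℝ f)
    {ψ : ℝ → E} (hψ : Continuous ψ) {σ α : ℝ} (hσ : 0 ≤ σ) (hα : 0 < α)
    (hd : ∀ s ∈ Set.Ico 0 σ, HasDerivAt ψ (-gradient f (ψ s)) s)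
    (hpos : ∀ s ∈ Set.Ico 0 σ, 0 < f (ψ s))
    (hbound : ∀ s ∈ Set.Ico 0 σ, α * f (ψ s) ≤ ‖gradient f (ψ s)‖ ^ 2) :
    ‖ψ σ - ψ 0‖ ≤ 2 / √α * √(f (ψ 0)) := by
  have key : ‖ψ σ - ψ 0‖ ≤ 2 / √α * (√(f (ψ 0)) - √(f (ψ σ))) := by
    have hcont : Continuous fun s => f (ψ s) := hf.continuous.comp hψ
    refine image_norm_le_of_norm_deriv_right_le_deriv_boundary' (f := fun s => ψ s - ψ 0)
      (f' := fun s => -gradient f (ψ s))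
      (B := fun s => 2 / √α * (√(f (ψ 0)) - √(f (ψ s))))
      (B' := fun s => 2 / √α * -(-‖gradient f (ψ s)‖ ^ 2 / (2 * √(f (ψ s)))))
      (by fun_prop) (fun s hs => ((hd s hs).sub_const _).hasDerivWithinAt) (by simp)
      ((continuous_const.sub hcont.sqrt).const_mul _).continuousOn (fun s hs => ?_) (fun s hs => ?_) (Set.right_mem_Icc.2 hσ)
    · exact ((((hasDerivAt_comp_gradientFlow (hf _) (hd s hs)).sqrt
        (hpos s hs).ne').const_sub _).const_mul _).hasDerivWithinAt
    · have ha := Real.sqrt_pos.2 hα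
      have hg := Real.sqrt_pos.2 (hpos s hs)
      have hN : √α * √(f (ψ s)) ≤ ‖gradient f (ψ s)‖ := by
        rw [← Real.sqrt_mul hα.le]
        exact (Real.sqrt_le_sqrt (hbound s hs)).trans_eq (Real.sqrt_sq (norm_nonneg _))
      have heq : 2 / √α * -(-‖gradient f (ψ s)‖ ^ 2 / (2 * √(f (ψ s)))) =
          ‖gradient f (ψ s)‖ ^ 2 / (√α * √(f (ψ s))) := by
        field_simp
      rw [norm_neg, heq, le_div_iff₀ (by positivity), sq]
      exact mul_le_mul_of_nonneg_left hN (norm_nonneg _)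
  refine key.trans (mul_le_mul_of_nonneg_left ?_ (by positivity))
  linarith [Real.sqrt_nonneg (f (ψ σ))]

theorem gradientFlow_eq_of_eq_zero {E : Type*} [NormedAddCommGroup E]
    [InnerProductSpace ℝ E] [CompleteSpace E] {f : E → ℝ} (hf : Differentiable ℝ f)
    (hf0 : ∀ x, 0 ≤ f x) {ψ : ℝ → E} (hψ : Continuous ψ) {σ t : ℝ} (hσt : σ ≤ t)
    (hd : ∀ s ∈ Set.Icc σ t, HasDerivAt ψ (-gradient f (ψ s)) s) (hzero : f (ψ σ) = 0) :
    ψ t = ψ σ := by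
  have hanti : AntitoneOn (fun s => f (ψ s)) (Set.Icc σ t) := by
    refine antitoneOn_of_hasDerivWithinAt_nonpos (convex_Icc σ t)
      (hf.continuous.comp hψ).continuousOn
      (fun s hs => (hasDerivAt_comp_gradientFlow (hf _)
        (hd s (interior_subset hs))).hasDerivWithinAt) (fun s _ => ?_)
    simp
  refine constant_of_has_deriv_right_zero hψ.continuousOn (fun s hs => ?_) t
    (Set.right_mem_Icc.2 hσt)
  have hs' := Set.Ico_subset_Icc_self hs
  have h0 : f (ψ s) = 0 :=
    le_antisymm (hzero ▸ hanti (Set.left_mem_Icc.2 hσt) hs' hs.1) (hf0 _)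
  simpa [gradient_eq_zero_of_nonneg_of_eq_zero hf0 h0] using (hd s hs').hasDerivWithinAt

/-- **Lemma 3.8.** Under the assumption `4 f(x₀) < r² α` (with `α = α(x₀,r)` formalized via its
defining lower-bound property), the gradient flow `φ = φ_{x₀}` cannot visit the boundary of
`B(x₀,r)`: `‖φ(t) − x₀‖ < r` for all `t ∈ [0, T_{x₀})`. -/
theorem flow_stays_in_open_ball
    {p : ℕ} (hp : 0 < p)
    (f : EuclideanSpace ℝ (Fin p) → ℝ)
    (hf : ContDiff ℝ 2 f) (hf0 : ∀ x, 0 ≤ f x)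
    (x₀ : EuclideanSpace ℝ (Fin p)) (r : ℝ) (hr : 0 < r)
    (α : ℝ)
    (hα : ∀ x ∈ Metric.closedBall x₀ r, f x ≠ 0 → α * f x ≤ ‖gradient f x‖ ^ 2)
    (hmain : 4 * f x₀ < r ^ 2 * α) :
    ∀ t : ℝ, 0 ≤ t → ENNReal.ofReal t < flowTime f x₀ → ‖flow f x₀ t - x₀‖ < r := by
  intro t ht htT
  have hfd : Differentiable ℝ f := hf.differentiable (by norm_num)
  have hgrad : Continuous (gradient f) :=
    (InnerProductSpace.toDual ℝ _).symm.continuous.comp (hf.continuous_fderiv (by norm_num))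
  obtain ⟨T, hT, htT⟩ : ∃ T, GoodTime f x₀ T ∧ t < T := by
    simp only [flowTime, lt_iSup_iff] at htT
    obtain ⟨T, hT, h⟩ := htT
    exact ⟨T, hT, (ENNReal.ofReal_lt_ofReal_iff_of_nonneg ht).1 h⟩
  have hex := hT.2 t ht htT.le
  have hflow : flow f x₀ t = Classical.choose hex t := by
    rw [flow, dif_pos hex]
  obtain ⟨ψ, hψ0, hψφ, hψ, hd⟩ :=
    (Classical.choose_spec hex).1.exists_hasDerivAt ht hgrad
  rw [hflow, ← hψφ (Set.right_mem_Icc.2 ht)]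
  have hαpos : 0 < α := by
    have := hf0 x₀
    exact pos_of_mul_pos_right (by linarith : 0 < r ^ 2 * α) (by positivity)
  have hinside : ∀ σ ∈ Set.Icc 0 t,
      (∀ s ∈ Set.Ico 0 σ, 0 < f (ψ s) ∧ ‖ψ s - x₀‖ < r) → ‖ψ σ - x₀‖ < r := by
    intro σ hσ h
    have hle := norm_sub_le_of_gradientFlow hfd hψ hσ.1 hαpos
      (fun s hs => hd s ⟨hs.1, hs.2.le.trans hσ.2⟩) (fun s hs => (h s hs).1)
      (fun s hs => hα _ (mem_closedBall_iff_norm.2 (h s hs).2.le) (h s hs).1.ne')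
    rw [hψ0] at hle
    refine hle.trans_lt ?_
    have ha := Real.sqrt_pos.2 hαpos
    rw [div_mul_eq_mul_div, div_lt_iff₀ ha]
    refine lt_of_pow_lt_pow_left₀ 2 (by positivity) ?_
    rw [mul_pow, mul_pow, Real.sq_sqrt (hf0 _), Real.sq_sqrt hαpos.le]
    linarith
  by_cases hall : ∀ s ∈ Set.Ico 0 t, 0 < f (ψ s) ∧ ‖ψ s - x₀‖ < r
  · exact hinside t (Set.right_mem_Icc.2 ht) hall
  set Z : Set ℝ := Set.Icc 0 t ∩ ({s | f (ψ s) ≤ 0} ∪ {s | r ≤ ‖ψ s - x₀‖})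
  have hZne : Z.Nonempty := by
    push Not at hall
    obtain ⟨s, hs, h⟩ := hall
    exact ⟨s, Set.Ico_subset_Icc_self hs, (le_or_gt (f (ψ s)) 0).imp id h⟩
  have hZc : IsCompact Z := isCompact_Icc.inter_right <|
    (isClosed_le (hfd.continuous.comp hψ) continuous_const).union
      (isClosed_le continuous_const (by fun_prop))
  obtain ⟨σ, ⟨hσ, hσZ⟩, hmin⟩ := hZc.exists_isLeast hZne
  have hlt : ‖ψ σ - x₀‖ < r := by
    refine hinside σ hσ fun s hs => ?_
    by_contra hcon
    rw [not_and_or, not_lt, not_lt] at hcon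
    exact hs.2.not_ge (hmin ⟨⟨hs.1, hs.2.le.trans hσ.2⟩, hcon⟩)
  have hzero : f (ψ σ) = 0 :=
    le_antisymm (hσZ.resolve_right fun h => hlt.not_ge h) (hf0 _)
  rwa [gradientFlow_eq_of_eq_zero hfd hf0 hψ hσ.2
    (fun s hs => hd s ⟨hσ.1.trans hs.1, hs.2⟩) hzero]
end
end

section
/- Let f : ℝ^d × ℝ^p → ℝ be continuously differentiable in its second argument, let x₁,…,x_n ∈ ℝ^d and y₁,…,y_n ∈ ℝ, and define S(w) := (1/n) Σ_{i=1}^n (y_i − f(x_i,w))². Let H(w) be the n×n matrix with entries H_{ij}(w) := ∇_w f(x_i,w) · ∇_w f(x_j,w), and let λ(w) denote the minimum eigenvalue of H(w). Then for any w ∈ ℝ^p with S(w) ≠ 0, |∇S(w)|² / S(w) ≥ (4/n) λ(w). -/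
open Set Filter RealInnerProductSpace

open scoped MatrixOrder in
theorem Matrix.IsHermitian.iInf_eigenvalues_mul_dotProduct_self_le {ι : Type*} [Fintype ι]
    [DecidableEq ι] {A : Matrix ι ι ℝ} (hA : A.IsHermitian) (v : ι → ℝ) :
    (⨅ i, hA.eigenvalues i) * (v ⬝ᵥ v) ≤ v ⬝ᵥ A.mulVec v := by
  have hle : algebraMap ℝ (Matrix ι ι ℝ) (⨅ i, hA.eigenvalues i) ≤ A := by
    refine (algebraMap_le_iff_le_spectrum (ha := hA)).2 fun t ht => ?_
    rw [hA.spectrum_real_eq_range_eigenvalues] at ht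
    obtain ⟨i, rfl⟩ := ht
    exact ciInf_le (Set.finite_range _).bddBelow i
  have hpos := (Matrix.le_iff.1 hle).dotProduct_mulVec_nonneg v
  simpa [Matrix.sub_mulVec, dotProduct_sub, Algebra.algebraMap_eq_smul_one, Matrix.smul_mulVec,
    dotProduct_smul] using hpos

theorem dotProduct_gram_mulVec_self {ι E : Type*} [Fintype ι] [NormedAddCommGroup E]
    [InnerProductSpace ℝ E] (g : ι → E) (v : ι → ℝ) :
    v ⬝ᵥ (Matrix.gram ℝ g).mulVec v = ‖∑ i, v i • g i‖ ^ 2 := by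
  rw [← real_inner_self_eq_norm_sq]
  simp only [dotProduct, Matrix.mulVec, Matrix.gram_apply, sum_inner, inner_sum,
    real_inner_smul_left, real_inner_smul_right, Finset.mul_sum]
  exact Finset.sum_congr rfl fun i _ => Finset.sum_congr rfl fun j _ => by
    rw [real_inner_comm]; ring

theorem hasGradientAt_const_mul_sum_sq_sub {ι E : Type*} [Fintype ι] [NormedAddCommGroup E]
    [InnerProductSpace ℝ E] [CompleteSpace E] {F : ι → E → ℝ} {w : E}
    (hF : ∀ i, DifferentiableAt ℝ (F i) w) (c : ℝ) (y : ι → ℝ) :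
    HasGradientAt (fun w => c * ∑ i, (y i - F i w) ^ 2)
      ((-(2 * c)) • ∑ i, (y i - F i w) • gradient (F i) w) w := by
  rw [hasGradientAt_iff_hasFDerivAt]
  have hderiv := (HasFDerivAt.fun_sum (u := Finset.univ) fun i _ =>
    ((hF i).hasGradientAt.hasFDerivAt.const_sub (y i)).pow 2).const_mul c
  refine hderiv.congr_fderiv ?_
  ext u
  simp only [map_smul, map_sum, smul_apply, sum_apply, neg_apply, smul_eq_mul,
    Finset.mul_sum]
  exact Finset.sum_congr rfl fun i _ => by simp; ring

/-- **Inequality (5.1).** Let `f : ℝ^d × ℝ^p → ℝ` be continuously differentiable in its second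
argument, `x₁,…,x_n ∈ ℝ^d`, `y₁,…,y_n ∈ ℝ`, and `S(w) = (1/n) Σᵢ (yᵢ − f(xᵢ,w))²`. Let `H(w)` be
the `n×n` Gram matrix `H_{ij}(w) = ∇_w f(xᵢ,w) ⬝ ∇_w f(xⱼ,w)` and `λ(w)` its minimum eigenvalue.
Then for any `w` with `S(w) ≠ 0`, `‖∇S(w)‖²/S(w) ≥ (4/n) λ(w)`. -/
theorem gradient_loss_ratio_ge_min_eigenvalue
    {d p n : ℕ} (hn : 0 < n)
    (f : EuclideanSpace ℝ (Fin d) → EuclideanSpace ℝ (Fin p) → ℝ)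
    (hf : ∀ x, ContDiff ℝ 1 (f x))
    (x : Fin n → EuclideanSpace ℝ (Fin d)) (y : Fin n → ℝ)
    (S : EuclideanSpace ℝ (Fin p) → ℝ)
    (hS : S = fun w => (1 / (n:ℝ)) * ∑ i, (y i - f (x i) w) ^ 2)
    (w : EuclideanSpace ℝ (Fin p))
    (H : Matrix (Fin n) (Fin n) ℝ)
    (hH : H = fun i j => ⟪gradient (f (x i)) w, gradient (f (x j)) w⟫)
    (hHsymm : H.IsHermitian)
    (lam : ℝ) (hlam : lam = ⨅ i, hHsymm.eigenvalues i)
    (hSw : S w ≠ 0) :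
    (4 / (n:ℝ)) * lam ≤ ‖gradient S w‖ ^ 2 / S w := by
  subst hS hlam
  have hpos := lt_of_le_of_ne (by positivity) hSw.symm
  rw [le_div_iff₀ hpos, (hasGradientAt_const_mul_sum_sq_sub
    (fun i => ((hf (x i)).differentiable one_ne_zero) w) (1 / (n : ℝ)) y).gradient, norm_smul,
    mul_pow, ← dotProduct_gram_mulVec_self (fun i => gradient (f (x i)) w)
    (fun i => y i - f (x i) w)]
  have hgram : Matrix.gram ℝ (fun i => gradient (f (x i)) w) = H := hH.symm
  have hquad := hHsymm.iInf_eigenvalues_mul_dotProduct_self_le (fun i => y i - f (x i) w)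
  have hdot : (fun i => y i - f (x i) w) ⬝ᵥ (fun i => y i - f (x i) w) =
      ∑ i, (y i - f (x i) w) ^ 2 := by
    simp only [dotProduct, sq]
  rw [hdot] at hquad
  rw [hgram, Real.norm_eq_abs, sq_abs]
  calc _ = (-(2 * (1 / (n : ℝ)))) ^ 2 *
        ((⨅ i, hHsymm.eigenvalues i) * ∑ i, (y i - f (x i) w) ^ 2) := by ring
    _ ≤ _ := by gcongr
end

section
/- Consider a feedforward neural network with depth L ≥ 2, d_L = 1, σ_L the identity, and σ₁,…,σ_{L−1} continuously differentiable. Let x₁,…,x_n ∈ ℝ^d, let X be the d×n matrix with i-th column x_i, and let α be the minimum eigenvalue of (1/n) XᵀX. For a parameter point w, let H(w) be the n×n matrix with entries H_{ij}(w) := ∇_w f(x_i,w) · ∇_w f(x_j,w), and let λ(w) be its minimum eigenvalue. Then λ(w) ≥ n α Σ_{r=1}^{d₁} min_{1 ≤ i ≤ n} q_r(x_i,w)², where q_r(x,w) := W_L D_{L−1}(x,w) W_{L−1} ⋯ W₂ D₁(x,w) e_r and e_r ∈ ℝ^{d₁} is the r-th standard basis vector. -/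
open Set Filter RealInnerProductSpace

noncomputable section

/-- `dimSeq d dims ℓ` is the dimension of layer `ℓ`: the input layer (layer `0`) has dimension
`d`, and layer `ℓ ≥ 1` has dimension `dims ℓ` (`= d_ℓ` in the paper). -/
def dimSeq (d : ℕ) (dims : ℕ → ℕ) : ℕ → ℕ
  | 0 => d
  | (ℓ + 1) => dims (ℓ + 1)

/-- Forward pass of the feedforward network. `W ℓ` is the weight matrix mapping layer `ℓ` into
layer `ℓ+1` (so `W ℓ = W_{ℓ+1}` in the paper's 1-based indexing), `b ℓ` is the bias vector of
layer `ℓ+1` (`= b_{ℓ+1}`), and `σ ℓ` is the activation function of layer `ℓ+1` (`= σ_{ℓ+1}`).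
`layerVal … ℓ` is the value `f_ℓ(x,w)` of layer `ℓ` on the input `x`. -/
def layerVal (d : ℕ) (dims : ℕ → ℕ) (σ : ℕ → ℝ → ℝ)
    (W : (ℓ : ℕ) → Fin (dimSeq d dims (ℓ + 1)) → Fin (dimSeq d dims ℓ) → ℝ)
    (b : (ℓ : ℕ) → Fin (dimSeq d dims (ℓ + 1)) → ℝ)
    (x : Fin d → ℝ) : (ℓ : ℕ) → Fin (dimSeq d dims ℓ) → ℝ
  | 0 => x
  | (ℓ + 1) => fun i =>
      σ ℓ ((∑ j, W ℓ i j * layerVal d dims σ W b x ℓ j) + b ℓ i)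

/-- The scalar output `f(x,w)` of a depth-`L` network (the output layer has dimension
`d_L = 1`; we sum over the output coordinates). -/
def netOut (d : ℕ) (dims : ℕ → ℕ) (L : ℕ) (σ : ℕ → ℝ → ℝ)
    (W : (ℓ : ℕ) → Fin (dimSeq d dims (ℓ + 1)) → Fin (dimSeq d dims ℓ) → ℝ)
    (b : (ℓ : ℕ) → Fin (dimSeq d dims (ℓ + 1)) → ℝ)
    (x : Fin d → ℝ) : ℝ :=
  ∑ i : Fin (dimSeq d dims L), layerVal d dims σ W b x L i

/-- The parameter space `ℝ^p`, `p = Σ_{ℓ=1}^L d_ℓ (d_{ℓ−1} + 1)`, of a depth-`L` network: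
for each layer `ℓ+1` (`0 ≤ ℓ < L`) it records a `d_{ℓ+1} × (d_ℓ + 1)` real matrix whose first
`d_ℓ` columns form the weight matrix `W_{ℓ+1}` and whose last column is the bias `b_{ℓ+1}`. -/
abbrev ParamSpace (d : ℕ) (dims : ℕ → ℕ) (L : ℕ) :=
  PiLp 2 (fun ℓ : Fin L =>
    EuclideanSpace ℝ (Fin (dimSeq d dims (ℓ.1 + 1)) × Fin (dimSeq d dims ℓ.1 + 1)))

/-- The weight matrix `W_{ℓ+1}` encoded in a parameter vector `w` (zero beyond layer `L`). -/
def paramW (d : ℕ) (dims : ℕ → ℕ) (L : ℕ) (w : ParamSpace d dims L) (ℓ : ℕ) :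
    Fin (dimSeq d dims (ℓ + 1)) → Fin (dimSeq d dims ℓ) → ℝ :=
  fun i j => if h : ℓ < L then w ⟨ℓ, h⟩ (i, Fin.castSucc j) else 0

/-- The bias vector `b_{ℓ+1}` encoded in a parameter vector `w` (zero beyond layer `L`). -/
def paramB (d : ℕ) (dims : ℕ → ℕ) (L : ℕ) (w : ParamSpace d dims L) (ℓ : ℕ) :
    Fin (dimSeq d dims (ℓ + 1)) → ℝ :=
  fun i => if h : ℓ < L then w ⟨ℓ, h⟩ (i, Fin.last _) else 0

/-- `netFun d dims L σ w x = f(x,w)`, the network output as a function of the parameter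
vector `w` and the input `x`. -/
def netFun (d : ℕ) (dims : ℕ → ℕ) (L : ℕ) (σ : ℕ → ℝ → ℝ)
    (w : ParamSpace d dims L) (x : Fin d → ℝ) : ℝ :=
  netOut d dims L σ (paramW d dims L w) (paramB d dims L w) x

/-- The squared error loss `S(w) = (1/n) Σ_{i=1}^n (y_i − f(x_i,w))²`. -/
def lossS (d : ℕ) (dims : ℕ → ℕ) (L : ℕ) (σ : ℕ → ℝ → ℝ) (n : ℕ)
    (x : Fin n → Fin d → ℝ) (y : Fin n → ℝ) (w : ParamSpace d dims L) : ℝ :=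
  (1 / (n : ℝ)) * ∑ i, (y i - netFun d dims L σ w (x i)) ^ 2

/-- Gradient descent iterates `w_{k+1} = w_k − η ∇S(w_k)` started at `w₀`. -/
def gdSeq {P : Type*} [NormedAddCommGroup P] [InnerProductSpace ℝ P] [CompleteSpace P]
    (S : P → ℝ) (η : ℝ) (w₀ : P) : ℕ → P
  | 0 => w₀
  | (k + 1) => gdSeq S η w₀ k - η • gradient S (gdSeq S η w₀ k)

/-- The pre-activation `g_{ℓ+1}(x,w)` of layer `ℓ+1`. -/
def preact (d : ℕ) (dims : ℕ → ℕ) (σ : ℕ → ℝ → ℝ)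
    (W : (ℓ : ℕ) → Fin (dimSeq d dims (ℓ + 1)) → Fin (dimSeq d dims ℓ) → ℝ)
    (b : (ℓ : ℕ) → Fin (dimSeq d dims (ℓ + 1)) → ℝ)
    (x : Fin d → ℝ) (ℓ : ℕ) : Fin (dimSeq d dims (ℓ + 1)) → ℝ :=
  fun i => (∑ j, W ℓ i j * layerVal d dims σ W b x ℓ j) + b ℓ i

/-- The chain vector `v_ℓ := D_{ℓ+1}(x,w) W_{ℓ+1} ⋯ W₂ D₁(x,w) e_i` (paper indexing), where
`D_ℓ(x,w)` is the diagonal matrix whose diagonal is `σ_ℓ'(g_ℓ(x,w))` and `e_i ∈ ℝ^{d₁}` is the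
`i`-th standard basis vector. -/
def chainVec (d : ℕ) (dims : ℕ → ℕ) (σ : ℕ → ℝ → ℝ)
    (W : (ℓ : ℕ) → Fin (dimSeq d dims (ℓ + 1)) → Fin (dimSeq d dims ℓ) → ℝ)
    (b : (ℓ : ℕ) → Fin (dimSeq d dims (ℓ + 1)) → ℝ)
    (x : Fin d → ℝ) (i : Fin (dimSeq d dims 1)) :
    (ℓ : ℕ) → Fin (dimSeq d dims (ℓ + 1)) → ℝ
  | 0 => fun r => deriv (σ 0) (preact d dims σ W b x 0 r) * (if r = i then 1 else 0)
  | (ℓ + 1) => fun r =>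
      deriv (σ (ℓ + 1)) (preact d dims σ W b x (ℓ + 1) r) *
        ∑ j, W (ℓ + 1) r j * chainVec d dims σ W b x i ℓ j

/-- `q_i(x,w) := W_L D_{L−1}(x,w) W_{L−1} ⋯ W₂ D₁(x,w) e_i`, a scalar since `d_L = 1` (we sum
over the output coordinates). Defined for depth `L ≥ 2`; junk value `0` for `L ≤ 1`. -/
def qVal (d : ℕ) (dims : ℕ → ℕ) (σ : ℕ → ℝ → ℝ)
    (W : (ℓ : ℕ) → Fin (dimSeq d dims (ℓ + 1)) → Fin (dimSeq d dims ℓ) → ℝ)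
    (b : (ℓ : ℕ) → Fin (dimSeq d dims (ℓ + 1)) → ℝ)
    (x : Fin d → ℝ) (i : Fin (dimSeq d dims 1)) : (L : ℕ) → ℝ
  | 0 => 0
  | 1 => 0
  | (M + 2) =>
      ∑ r : Fin (dimSeq d dims (M + 2)), ∑ j : Fin (dimSeq d dims (M + 1)),
        W (M + 1) r j * chainVec d dims σ W b x i M j

section Differentiability

variable {d : ℕ} {dims : ℕ → ℕ} {L : ℕ} {σ : ℕ → ℝ → ℝ}

lemma differentiable_paramW (ℓ : ℕ) (i : Fin (dimSeq d dims (ℓ + 1)))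
    (j : Fin (dimSeq d dims ℓ)) :
    Differentiable ℝ (fun v : ParamSpace d dims L => paramW d dims L v ℓ i j) := by
  unfold paramW
  split_ifs <;> fun_prop

lemma differentiable_paramB (ℓ : ℕ) (i : Fin (dimSeq d dims (ℓ + 1))) :
    Differentiable ℝ (fun v : ParamSpace d dims L => paramB d dims L v ℓ i) := by
  unfold paramB
  split_ifs <;> fun_prop

lemma differentiable_layerVal (x : Fin d → ℝ) (ℓ : ℕ) (hσ : ∀ k < ℓ, Differentiable ℝ (σ k))
    (i : Fin (dimSeq d dims ℓ)) :
    Differentiable ℝ (fun v : ParamSpace d dims L =>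
      layerVal d dims σ (paramW d dims L v) (paramB d dims L v) x ℓ i) := by
  induction ℓ with
  | zero => exact differentiable_const (x i)
  | succ ℓ ih =>
    refine (hσ ℓ (Nat.lt_succ_self ℓ)).comp (Differentiable.add ?_ (differentiable_paramB ℓ i))
    exact Differentiable.fun_sum fun j _ =>
      (differentiable_paramW ℓ i j).mul (ih (fun k hk => hσ k (Nat.lt_succ_of_lt hk)) j)

lemma differentiable_netFun (x : Fin d → ℝ) (hσ : ∀ k < L, Differentiable ℝ (σ k)) :
    Differentiable ℝ (fun v : ParamSpace d dims L => netFun d dims L σ v x) := by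
  unfold netFun netOut
  exact Differentiable.fun_sum fun i _ => differentiable_layerVal x L hσ i

end Differentiability

section FirstLayer

variable {d : ℕ} {dims : ℕ → ℕ} {M : ℕ} {σ : ℕ → ℝ → ℝ}

/-- The unit vector of parameter space in the direction of the entry `(r, s)` of the first weight
matrix. -/
def firstWeightDir (d : ℕ) (dims : ℕ → ℕ) (M : ℕ) (r : Fin (dimSeq d dims 1)) (s : Fin d) :
    ParamSpace d dims (M + 1) :=
  WithLp.toLp 2 fun k => WithLp.toLp 2 fun p =>
    if k.1 = 0 ∧ p.1.1 = r.1 ∧ p.2.1 = s.1 then 1 else 0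

lemma firstWeightDir_apply (r : Fin (dimSeq d dims 1)) (s : Fin d) (k : Fin (M + 1))
    (i : Fin (dimSeq d dims (k.1 + 1))) (j : Fin (dimSeq d dims k.1 + 1)) :
    firstWeightDir d dims M r s k (i, j) =
      if k.1 = 0 ∧ i.1 = r.1 ∧ j.1 = s.1 then 1 else 0 := rfl

lemma inner_firstWeightDir (g : ParamSpace d dims (M + 1)) (r : Fin (dimSeq d dims 1))
    (s : Fin d) : ⟪g, firstWeightDir d dims M r s⟫ = g 0 (r, Fin.castSucc s) := by
  rw [PiLp.inner_apply, Finset.sum_eq_single 0]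
  · rw [PiLp.inner_apply]
    refine (Finset.sum_eq_single (r, Fin.castSucc s) ?_ ?_).trans ?_
    · rintro ⟨i, j⟩ _ hij
      have h : firstWeightDir d dims M r s 0 (i, j) = 0 :=
        if_neg fun h => hij (Prod.ext (Fin.ext h.2.1) (Fin.ext h.2.2))
      exact (congrArg (inner ℝ (g 0 (i, j))) h).trans (inner_zero_right _)
    · exact fun h => absurd (Finset.mem_univ _) h
    · have h : firstWeightDir d dims M r s 0 (r, Fin.castSucc s) = 1 := if_pos ⟨rfl, rfl, rfl⟩
      exact (congrArg (inner ℝ (g 0 (r, Fin.castSucc s))) h).trans (one_mul _)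
  · intro k _ hk
    rw [PiLp.inner_apply]
    refine Finset.sum_eq_zero fun p _ => ?_
    rw [firstWeightDir_apply, if_neg fun h => hk (Fin.ext h.1), inner_zero_right]
  · exact fun h => absurd (Finset.mem_univ _) h

lemma sum_sq_inner_firstWeightDir_le (g : ParamSpace d dims (M + 1)) :
    ∑ r, ∑ s, ⟪g, firstWeightDir d dims M r s⟫ ^ 2 ≤ ‖g‖ ^ 2 := by
  simp only [inner_firstWeightDir]
  calc ∑ r, ∑ s : Fin d, g 0 (r, Fin.castSucc s) ^ 2
      ≤ ∑ r, ∑ t : Fin (d + 1), g 0 (r, t) ^ 2 := by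
        refine Finset.sum_le_sum fun r _ => ?_
        rw [Fin.sum_univ_castSucc]
        exact le_add_of_nonneg_right (sq_nonneg _)
    _ = ‖g 0‖ ^ 2 := by
        rw [EuclideanSpace.real_norm_sq_eq, Fintype.sum_prod_type]
        rfl
    _ ≤ ‖g‖ ^ 2 := by
        rw [PiLp.norm_sq_eq_of_L2 _ g]
        exact Finset.single_le_sum (f := fun k => ‖g k‖ ^ 2) (fun k _ => sq_nonneg _)
          (Finset.mem_univ 0)

lemma paramW_zero_line (w : ParamSpace d dims (M + 1)) (r : Fin (dimSeq d dims 1)) (s : Fin d)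
    (t : ℝ) (i : Fin (dimSeq d dims 1)) (j : Fin d) :
    paramW d dims (M + 1) (w + t • firstWeightDir d dims M r s) 0 i j =
      paramW d dims (M + 1) w 0 i j + t * if i = r ∧ j = s then 1 else 0 := by
  have h : firstWeightDir d dims M r s 0 (i, Fin.castSucc j) =
      if i = r ∧ j = s then 1 else 0 := by
    refine (firstWeightDir_apply r s 0 i (Fin.castSucc j)).trans (if_congr ?_ rfl rfl)
    rw [Fin.ext_iff, Fin.ext_iff]
    exact and_iff_right rfl
  rw [← h]
  rfl

lemma paramW_succ_line (w : ParamSpace d dims (M + 1)) (r : Fin (dimSeq d dims 1)) (s : Fin d)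
    (t : ℝ) (ℓ : ℕ) :
    paramW d dims (M + 1) (w + t • firstWeightDir d dims M r s) (ℓ + 1) =
      paramW d dims (M + 1) w (ℓ + 1) := by
  funext i j
  unfold paramW
  split_ifs
  · simp [firstWeightDir_apply]
  · rfl

lemma paramB_line (w : ParamSpace d dims (M + 1)) (r : Fin (dimSeq d dims 1)) (s : Fin d)
    (t : ℝ) (ℓ : ℕ) :
    paramB d dims (M + 1) (w + t • firstWeightDir d dims M r s) ℓ =
      paramB d dims (M + 1) w ℓ := by
  funext i
  unfold paramB
  split_ifs with h
  · have h0 : firstWeightDir d dims M r s ⟨ℓ, h⟩ (i, Fin.last _) = 0 := by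
      rw [firstWeightDir_apply, if_neg]
      rintro ⟨rfl, -, hs⟩
      exact s.2.ne' hs
    simp [h0]
  · rfl

lemma hasLineDerivAt_layerVal_succ {w e : ParamSpace d dims (M + 1)} {x : Fin d → ℝ} {ℓ : ℕ}
    {i : Fin (dimSeq d dims (ℓ + 1))} {p' : ℝ} (hσ : Differentiable ℝ (σ ℓ))
    (hp : HasLineDerivAt ℝ (fun v : ParamSpace d dims (M + 1) =>
      preact d dims σ (paramW d dims (M + 1) v) (paramB d dims (M + 1) v) x ℓ i) p' w e) :
    HasLineDerivAt ℝ (fun v : ParamSpace d dims (M + 1) =>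
        layerVal d dims σ (paramW d dims (M + 1) v) (paramB d dims (M + 1) v) x (ℓ + 1) i)
      (deriv (σ ℓ) (preact d dims σ (paramW d dims (M + 1) w) (paramB d dims (M + 1) w) x ℓ i)
        * p') w e := by
  have h := (hσ (preact d dims σ (paramW d dims (M + 1) (w + (0 : ℝ) • e))
    (paramB d dims (M + 1) (w + (0 : ℝ) • e)) x ℓ i)).hasDerivAt.comp 0 hp
  rw [zero_smul, add_zero] at h
  exact h

lemma hasLineDerivAt_layerVal (w : ParamSpace d dims (M + 1)) (x : Fin d → ℝ)
    (r : Fin (dimSeq d dims 1)) (s : Fin d) (ℓ : ℕ) (hσ : ∀ k ≤ ℓ, Differentiable ℝ (σ k))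
    (i : Fin (dimSeq d dims (ℓ + 1))) :
    HasLineDerivAt ℝ (fun v : ParamSpace d dims (M + 1) =>
        layerVal d dims σ (paramW d dims (M + 1) v) (paramB d dims (M + 1) v) x (ℓ + 1) i)
      (chainVec d dims σ (paramW d dims (M + 1) w) (paramB d dims (M + 1) w) x r ℓ i * x s)
      w (firstWeightDir d dims M r s) := by
  induction ℓ with
  | zero =>
    rw [chainVec, mul_assoc]
    refine hasLineDerivAt_layerVal_succ (hσ 0 le_rfl) ?_
    have hp : HasDerivAt (fun t : ℝ => (∑ j : Fin d,
        paramW d dims (M + 1) (w + t • firstWeightDir d dims M r s) 0 i j * x j) +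
          paramB d dims (M + 1) (w + t • firstWeightDir d dims M r s) 0 i)
        (∑ j : Fin d, (if i = r ∧ j = s then 1 else 0) * x j) 0 := by
      simp only [paramB_line]
      refine HasDerivAt.add_const _ (HasDerivAt.fun_sum fun j _ => HasDerivAt.mul_const ?_ _)
      simp only [paramW_zero_line]
      simpa using ((hasDerivAt_id (0 : ℝ)).mul_const
        (if i = r ∧ j = s then (1 : ℝ) else 0)).const_add (paramW d dims (M + 1) w 0 i j)
    have hsum : ∑ j : Fin d, (if i = r ∧ j = s then (1 : ℝ) else 0) * x j =
        (if i = r then 1 else 0) * x s := by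
      by_cases hi : i = r <;> simp [hi]
    rw [hsum] at hp
    exact hp
  | succ ℓ ih =>
    rw [chainVec, mul_assoc]
    refine hasLineDerivAt_layerVal_succ (hσ (ℓ + 1) le_rfl) ?_
    rw [Finset.sum_mul]
    unfold HasLineDerivAt preact
    simp only [paramB_line, paramW_succ_line, mul_assoc]
    exact HasDerivAt.add_const _ (HasDerivAt.fun_sum fun j _ =>
      (ih (fun k hk => hσ k (Nat.le_succ_of_le hk)) j).const_mul _)

lemma inner_gradient_netFun_firstWeightDir (w : ParamSpace d dims (M + 2)) (x : Fin d → ℝ)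
    (hσ : ∀ k < M + 2, Differentiable ℝ (σ k)) (hlast : ∀ t, σ (M + 1) t = t)
    (r : Fin (dimSeq d dims 1)) (s : Fin d) :
    ⟪gradient (fun v => netFun d dims (M + 2) σ v x) w, firstWeightDir d dims (M + 1) r s⟫ =
      qVal d dims σ (paramW d dims (M + 2) w) (paramB d dims (M + 2) w) x r (M + 2) * x s := by
  have hdiff : Differentiable ℝ (fun v => netFun d dims (M + 2) σ v x) :=
    differentiable_netFun x hσ
  have hid : σ (M + 1) = id := funext hlast
  rw [inner_gradient_left, ← (hdiff w).lineDeriv_eq_fderiv]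
  refine HasLineDerivAt.lineDeriv ?_
  have h : HasLineDerivAt ℝ (fun v => netFun d dims (M + 2) σ v x)
      (∑ i, chainVec d dims σ (paramW d dims (M + 2) w) (paramB d dims (M + 2) w) x r (M + 1) i
        * x s) w (firstWeightDir d dims (M + 1) r s) := by
    unfold netFun netOut
    exact HasDerivAt.fun_sum fun i _ =>
      hasLineDerivAt_layerVal w x r s (M + 1) (fun k hk => hσ k (Nat.lt_succ_of_le hk)) i
  rw [← Finset.sum_mul] at h
  simp only [chainVec, hid, deriv_id, one_mul] at h
  exact h

end FirstLayer

section Gram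

open Matrix

variable {E : Type*} [NormedAddCommGroup E] [InnerProductSpace ℝ E] {n : ℕ}

lemma le_iInf_eigenvalues_of_quadratic_form {H : Matrix (Fin n) (Fin n) ℝ} (hH : H.IsHermitian)
    (hn : 0 < n) (c : ℝ) (h : ∀ a : Fin n → ℝ, c * ∑ i, a i ^ 2 ≤ a ⬝ᵥ (H *ᵥ a)) :
    c ≤ ⨅ i, hH.eigenvalues i := by
  have : Nonempty (Fin n) := ⟨⟨0, hn⟩⟩
  refine le_ciInf fun i => ?_
  have h1 : ∑ j, (hH.eigenvectorBasis i) j ^ 2 = 1 := by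
    rw [← EuclideanSpace.real_norm_sq_eq, hH.eigenvectorBasis.norm_eq_one, one_pow]
  have h2 := h (hH.eigenvectorBasis i)
  rw [h1, mul_one] at h2
  rw [hH.eigenvalues_eq]
  simpa using h2

lemma dotProduct_gram_mulVec (g : Fin n → E) (a : Fin n → ℝ) :
    a ⬝ᵥ ((fun i k => ⟪g i, g k⟫ : Matrix (Fin n) (Fin n) ℝ) *ᵥ a) = ‖∑ i, a i • g i‖ ^ 2 := by
  rw [← real_inner_self_eq_norm_sq, sum_inner]
  simp only [dotProduct, mulVec, inner_sum, inner_smul_left, inner_smul_right]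
  refine Finset.sum_congr rfl fun i _ => ?_
  rw [Finset.mul_sum]
  refine Finset.sum_congr rfl fun k _ => ?_
  simp only [conj_trivial]
  ring

end Gram

/-- The lower bound for the quadratic form behind the eigenvalue estimate: `q r i` are arbitrary
weights and `x i` the data points. -/
lemma sum_iInf_sq_mul_le {ι : Type*} [Fintype ι] {n d : ℕ} (x : Fin n → Fin d → ℝ)
    {β : ℝ} (hβ : 0 ≤ β) (hx : ∀ a : Fin n → ℝ, β * ∑ i, a i ^ 2 ≤ ∑ s, (∑ i, a i * x i s) ^ 2)
    (q : ι → Fin n → ℝ) (a : Fin n → ℝ) :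
    β * (∑ r, ⨅ i, q r i ^ 2) * ∑ i, a i ^ 2 ≤
      ∑ r, ∑ s, (∑ i, a i * (q r i * x i s)) ^ 2 := by
  rw [mul_assoc, Finset.sum_mul, Finset.mul_sum]
  refine Finset.sum_le_sum fun r _ => ?_
  calc β * ((⨅ i, q r i ^ 2) * ∑ i, a i ^ 2) ≤ β * ∑ i, (a i * q r i) ^ 2 := by
        refine mul_le_mul_of_nonneg_left ?_ hβ
        rw [Finset.mul_sum]
        refine Finset.sum_le_sum fun i _ => ?_
        rw [mul_pow, mul_comm (a i ^ 2)]
        exact mul_le_mul_of_nonneg_right (ciInf_le (Set.finite_range _).bddBelow i) (sq_nonneg _)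
    _ ≤ ∑ s, (∑ i, a i * q r i * x i s) ^ 2 := hx fun i => a i * q r i
    _ = ∑ s, (∑ i, a i * (q r i * x i s)) ^ 2 := by simp only [mul_assoc]

/-- **Inequality (5.3).** For a depth-`L` network (`L ≥ 2`, `d_L = 1`, `σ_L = id`, `σ₁,…,σ_{L−1}`
continuously differentiable), data `x₁,…,x_n`, and `α` the minimum eigenvalue of `(1/n)XᵀX`
(formalized by its quadratic-form lower-bound property), the minimum eigenvalue `λ(w)` of the
Gram matrix `H(w)` with entries `H_{ik}(w) = ∇_w f(x_i,w) ⬝ ∇_w f(x_k,w)` satisfies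
`λ(w) ≥ n α Σ_{r=1}^{d₁} min_{1 ≤ i ≤ n} q_r(x_i,w)²`. -/
theorem min_eigenvalue_gram_lower_bound
    (d : ℕ) (dims : ℕ → ℕ) (L : ℕ) (hL : 2 ≤ L) (hdL : dims L = 1)
    (σ : ℕ → ℝ → ℝ)
    (hσ : ∀ ℓ, ℓ + 1 < L → ContDiff ℝ 1 (σ ℓ))
    (hσlast : ∀ t : ℝ, σ (L - 1) t = t)
    (n : ℕ) (hn : 0 < n)
    (x : Fin n → Fin d → ℝ) (α : ℝ)
    (hα : ∀ a : Fin n → ℝ,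
      α * ∑ i, a i ^ 2 ≤ (1 / (n : ℝ)) * ∑ s : Fin d, (∑ i, a i * x i s) ^ 2)
    (w : ParamSpace d dims L)
    (H : Matrix (Fin n) (Fin n) ℝ)
    (hH : H = fun i k =>
      ⟪gradient (fun v => netFun d dims L σ v (x i)) w,
        gradient (fun v => netFun d dims L σ v (x k)) w⟫)
    (hHsymm : H.IsHermitian) :
    (n : ℝ) * α * ∑ r : Fin (dimSeq d dims 1),
        ⨅ i : Fin n, (qVal d dims σ (paramW d dims L w) (paramB d dims L w) (x i) r L) ^ 2
      ≤ ⨅ i, hHsymm.eigenvalues i := by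
  obtain ⟨M, rfl⟩ := Nat.exists_eq_add_of_le' hL
  have hdiff : ∀ k < M + 2, Differentiable ℝ (σ k) := by
    intro k hk
    rcases Nat.lt_succ_iff_lt_or_eq.mp hk with hk | rfl
    · exact (hσ k (Nat.succ_lt_succ hk)).differentiable one_ne_zero
    · rw [show σ (M + 1) = id from funext hσlast]
      exact differentiable_id
  have hn' : (0 : ℝ) < n := Nat.cast_pos.mpr hn
  refine le_iInf_eigenvalues_of_quadratic_form hHsymm hn _ fun a => ?_
  rw [hH, dotProduct_gram_mulVec]
  rcases le_or_gt 0 α with h0 | h0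
  · refine le_trans ?_ (sum_sq_inner_firstWeightDir_le _)
    simp only [sum_inner, real_inner_smul_left,
      inner_gradient_netFun_firstWeightDir w _ hdiff hσlast]
    refine sum_iInf_sq_mul_le x (mul_nonneg hn'.le h0) (fun a => ?_) _ a
    calc (n : ℝ) * α * ∑ i, a i ^ 2 = n * (α * ∑ i, a i ^ 2) := mul_assoc _ _ _
      _ ≤ n * (1 / n * ∑ s, (∑ i, a i * x i s) ^ 2) := mul_le_mul_of_nonneg_left (hα a) hn'.le
      _ = ∑ s, (∑ i, a i * x i s) ^ 2 := by field_simp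
  · refine le_trans (mul_nonpos_of_nonpos_of_nonneg (mul_nonpos_of_nonpos_of_nonneg
      (mul_nonpos_of_nonneg_of_nonpos hn'.le h0.le) ?_) ?_) (sq_nonneg _)
    · exact Finset.sum_nonneg fun r _ => Real.iInf_nonneg fun i => sq_nonneg _
    · exact Finset.sum_nonneg fun i _ => sq_nonneg _
end
end
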